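/- arXiv:2410.22019 — 2 statements merged into one kernel-verified Lean document; each statement's English description precedes it below -/
import Mathlib

section
/- There exists a constant c > 0 such that for all sufficiently large n, r_4(5,4;n) ≥ 2^{n^{c·log log n}} (logarithms base 2). -/
/-- The Erdős–Hajnal Ramsey function `r_k(k+1,t;n)`: the minimum `N` such that for every
red/blue coloring of the `k`-element subsets of an `N`-element set (`red = true`), there exist
`k+1` vertices spanning at least `t` red `k`-subsets, or there exist `n` vertices all of whose
`k`-subsets are blue. -/
noncomputable def ehRamsey (k t n : ℕ) : ℕ :=
  sInf {N : ℕ | ∀ χ : Finset ℕ → Bool,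
    (∃ S ⊆ Finset.range N, S.card = k + 1 ∧
        t ≤ ((S.powersetCard k).filter (fun e => χ e = true)).card) ∨
    (∃ T ⊆ Finset.range N, T.card = n ∧ ∀ e ∈ T.powersetCard k, χ e = false)}

/-- Every colouring of `(k+1)`-sets has a large subset on which the colour of a set depends only
on its minimum, provided the Ramsey property holds for `k`-sets. -/
theorem exists_minHomogeneous_subset {k : ℕ}
    (hk : ∀ n : ℕ, ∃ N : ℕ, ∀ χ : Finset ℕ → Bool, ∀ V : Finset ℕ, N ≤ V.card →
      ∃ T ⊆ V, T.card = n ∧ ∃ col, ∀ e ∈ T.powersetCard k, χ e = col) (m : ℕ) :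
    ∃ N : ℕ, ∀ χ : Finset ℕ → Bool, ∀ V : Finset ℕ, N ≤ V.card →
      ∃ T ⊆ V, T.card = m ∧ ∃ c : ℕ → Bool, ∀ e ∈ T.powersetCard (k + 1), ∀ x ∈ e,
        (∀ y ∈ e, x ≤ y) → χ e = c x := by
  induction m with
  | zero =>
    refine ⟨0, fun χ V _ => ⟨∅, by simp, rfl, fun _ => true, fun e he x hx => ?_⟩⟩
    rw [Finset.mem_powersetCard, Finset.subset_empty] at he
    simp [he.1] at hx
  | succ m ih =>
    obtain ⟨N₁, hN₁⟩ := ih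
    obtain ⟨N₂, hN₂⟩ := hk N₁
    refine ⟨N₂ + 1, fun χ V hV => ?_⟩
    have hne : V.Nonempty := Finset.card_pos.1 (by omega)
    set v := V.min' hne with hv
    have hvV : v ∈ V := V.min'_mem hne
    obtain ⟨T, hTV, hT, col, hcol⟩ := hN₂ (fun e => χ (insert v e)) (V.erase v)
      (by rw [Finset.card_erase_of_mem hvV]; omega)
    obtain ⟨U, hUT, hU, c, hc⟩ := hN₁ χ T hT.ge
    have hUV : U ⊆ V.erase v := hUT.trans hTV
    have hvU : v ∉ U := fun h => by simpa using hUV h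
    have hlt : ∀ y ∈ U, v < y := fun y hy => by
      have h := Finset.mem_erase.1 (hUV hy)
      exact lt_of_le_of_ne (V.min'_le y h.2) (Ne.symm h.1)
    refine ⟨insert v U, ?_, by rw [Finset.card_insert_of_notMem hvU, hU],
      Function.update c v col, fun e he x hx hmin => ?_⟩
    · exact Finset.insert_subset hvV (hUV.trans (Finset.erase_subset _ _))
    · rw [Finset.mem_powersetCard] at he
      by_cases hve : v ∈ e
      · have hxv : x = v := by
          rcases Finset.mem_insert.1 (he.1 hx) with h | h
          · exact h
          · exact absurd (hmin v hve) (not_le.2 (hlt x h))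
        subst hxv
        rw [Function.update_self, ← Finset.insert_erase hve]
        refine hcol _ (Finset.mem_powersetCard.2 ⟨fun y hy => ?_, ?_⟩)
        · have h := Finset.mem_erase.1 hy
          exact hUT ((Finset.mem_insert.1 (he.1 h.2)).resolve_left h.1)
        · rw [Finset.card_erase_of_mem hve, he.2]; rfl
      · have heU : e ⊆ U := fun y hy =>
          (Finset.mem_insert.1 (he.1 hy)).resolve_left (fun h => hve (h ▸ hy))
        rw [Function.update_of_ne (show x ≠ v from fun h => hve (h ▸ hx))]
        exact hc e (Finset.mem_powersetCard.2 ⟨heU, he.2⟩) x hx hmin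

/-- Ramsey's theorem for two-colourings of `k`-sets. -/
theorem exists_monochromatic_subset (k : ℕ) : ∀ n : ℕ, ∃ N : ℕ, ∀ χ : Finset ℕ → Bool,
    ∀ V : Finset ℕ, N ≤ V.card →
      ∃ T ⊆ V, T.card = n ∧ ∃ col, ∀ e ∈ T.powersetCard k, χ e = col := by
  induction k with
  | zero =>
    intro n
    refine ⟨n, fun χ V hV => ?_⟩
    obtain ⟨T, hT, hc⟩ := Finset.exists_subset_card_eq hV
    exact ⟨T, hT, hc, χ ∅, fun e he => by simp at he; rw [he]⟩
  | succ k ih =>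
    intro n
    obtain ⟨N, hN⟩ := exists_minHomogeneous_subset ih (2 * n)
    refine ⟨N, fun χ V hV => ?_⟩
    obtain ⟨T, hTV, hT, c, hc⟩ := hN χ V hV
    have hsplit := Finset.card_filter_add_card_filter_not (s := T) (fun x => c x = true)
    obtain ⟨col, hcol⟩ : ∃ col, n ≤ (T.filter (fun x => c x = col)).card := by
      by_contra! h
      have h1 := h true
      have h2 := h false
      simp only [Bool.not_eq_true] at hsplit
      omega
    obtain ⟨U, hU, hUc⟩ := Finset.exists_subset_card_eq hcol
    have hUT : U ⊆ T := hU.trans (Finset.filter_subset _ _)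
    refine ⟨U, hUT.trans hTV, hUc, col, fun e he => ?_⟩
    rw [Finset.mem_powersetCard] at he
    have hne : e.Nonempty := Finset.card_pos.1 (by omega)
    rw [hc e (Finset.mem_powersetCard.2 ⟨he.1.trans hUT, he.2⟩) _ (e.min'_mem hne)
      (fun y hy => e.min'_le y hy)]
    exact (Finset.mem_filter.1 (hU (he.1 (e.min'_mem hne)))).2

/-- The number of trailing binary digits that have to be deleted to make `u` and `v` equal. -/
def splitLevel (u v : ℕ) : ℕ :=
  Nat.find (p := fun d => u / 2 ^ d = v / 2 ^ d) ⟨u + v, by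
    rw [Nat.div_eq_of_lt (lt_of_le_of_lt (Nat.le_add_right u v) Nat.lt_two_pow_self),
      Nat.div_eq_of_lt (lt_of_le_of_lt (Nat.le_add_left v u) Nat.lt_two_pow_self)]⟩

theorem splitLevel_le_iff {u v d : ℕ} : splitLevel u v ≤ d ↔ u / 2 ^ d = v / 2 ^ d := by
  constructor
  · intro h
    have hs : u / 2 ^ splitLevel u v = v / 2 ^ splitLevel u v :=
      Nat.find_spec (p := fun d => u / 2 ^ d = v / 2 ^ d) _
    obtain ⟨e, rfl⟩ := Nat.exists_eq_add_of_le h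
    rw [pow_add, ← Nat.div_div_eq_div_mul, ← Nat.div_div_eq_div_mul, hs]
  · intro h
    exact Nat.find_min' _ h

theorem splitLevel_eq_max {u v w : ℕ} (huv : u ≤ v) (hvw : v ≤ w) :
    splitLevel u w = max (splitLevel u v) (splitLevel v w) := by
  refine eq_of_forall_ge_iff fun d => ?_
  rw [max_le_iff, splitLevel_le_iff, splitLevel_le_iff, splitLevel_le_iff]
  have h1 := Nat.div_le_div_right (c := 2 ^ d) huv
  have h2 := Nat.div_le_div_right (c := 2 ^ d) hvw
  constructor
  · intro h; constructor <;> omega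
  · rintro ⟨h, h'⟩; omega

theorem splitLevel_pos {u v : ℕ} (huv : u < v) : 0 < splitLevel u v := by
  by_contra! h
  have := splitLevel_le_iff.1 h
  simp at this
  omega

theorem splitLevel_le {u v N : ℕ} (hu : u < 2 ^ N) (hv : v < 2 ^ N) : splitLevel u v ≤ N := by
  rw [splitLevel_le_iff, Nat.div_eq_of_lt hu, Nat.div_eq_of_lt hv]

/-- The levels at which the members of `S` above `v` split from `v`. -/
def upLevels (S : Finset ℕ) (v : ℕ) : Finset ℕ := (S.filter (v < ·)).image (splitLevel v)

/-- The levels at which the members of `S` below `v` split from `v`. -/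
def downLevels (S : Finset ℕ) (v : ℕ) : Finset ℕ :=
  (S.filter (· < v)).image (fun u => splitLevel u v)

theorem upLevels_mono {S T : Finset ℕ} (h : S ⊆ T) (v : ℕ) : upLevels S v ⊆ upLevels T v :=
  Finset.image_subset_image (Finset.filter_subset_filter _ h)

theorem downLevels_mono {S T : Finset ℕ} (h : S ⊆ T) (v : ℕ) :
    downLevels S v ⊆ downLevels T v :=
  Finset.image_subset_image (Finset.filter_subset_filter _ h)

/-- A set of two or more numbers is cut by its top level into two smaller halves. -/
theorem exists_splitLevel_partition {S : Finset ℕ} (hS : 1 < S.card) :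
    ∃ d, ∃ A ⊆ S, ∃ B ⊆ S, S.card = A.card + B.card ∧ A.Nonempty ∧ B.Nonempty ∧
      (∀ u ∈ A, ∀ v ∈ B, u < v ∧ splitLevel u v = d) ∧
      (∀ u ∈ A, ∀ v ∈ A, splitLevel u v < d) ∧ (∀ u ∈ B, ∀ v ∈ B, splitLevel u v < d) := by
  have hne : S.Nonempty := Finset.card_pos.1 (by omega)
  set x := S.min' hne
  set y := S.max' hne
  have hx : x ∈ S := S.min'_mem hne
  have hy : y ∈ S := S.max'_mem hne
  have hxy : x < y := S.min'_lt_max'_of_card hS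
  obtain ⟨e, he⟩ := Nat.exists_eq_succ_of_ne_zero (splitLevel_pos hxy).ne'
  have hle : ∀ u ∈ S, ∀ v ∈ S, u / 2 ^ (e + 1) = v / 2 ^ (e + 1) := by
    have key : ∀ u ∈ S, u / 2 ^ (e + 1) = x / 2 ^ (e + 1) := by
      intro u hu
      have h1 : x ≤ u := S.min'_le u hu
      have h2 : u ≤ y := S.le_max' u hu
      have h3 := splitLevel_eq_max h1 h2
      exact (splitLevel_le_iff.1 (by omega)).symm
    intro u hu v hv
    rw [key u hu, key v hv]
  have hne' : x / 2 ^ e ≠ y / 2 ^ e := fun h' => by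
    have := splitLevel_le_iff.2 h'; omega
  have hlt : x / 2 ^ e < y / 2 ^ e :=
    lt_of_le_of_ne (Nat.div_le_div_right hxy.le) hne'
  have hdiv : ∀ u : ℕ, u / 2 ^ (e + 1) = u / 2 ^ e / 2 := fun u => by
    rw [pow_succ, Nat.div_div_eq_div_mul]
  have hval : ∀ u ∈ S, u / 2 ^ e ≠ x / 2 ^ e → u / 2 ^ e = x / 2 ^ e + 1 := by
    intro u hu hux
    have h1 := hle u hu x hx
    have h2 : x / 2 ^ e ≤ u / 2 ^ e := Nat.div_le_div_right (S.min'_le u hu)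
    rw [hdiv, hdiv] at h1
    omega
  refine ⟨e + 1, S.filter (fun u => u / 2 ^ e = x / 2 ^ e), Finset.filter_subset _ _,
    S.filter (fun u => ¬ u / 2 ^ e = x / 2 ^ e), Finset.filter_subset _ _,
    (Finset.card_filter_add_card_filter_not _).symm,
    ⟨x, by simp [hx]⟩, ⟨y, by simp [hy, hne'.symm]⟩, ?_, ?_, ?_⟩
  · intro u hu v hv
    rw [Finset.mem_filter] at hu hv
    have h1 := hval v hv.1 hv.2
    constructor
    · by_contra! h
      have := Nat.div_le_div_right (c := 2 ^ e) h
      omega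
    · refine le_antisymm (splitLevel_le_iff.2 (hle u hu.1 v hv.1)) ?_
      by_contra! h
      have := splitLevel_le_iff.1 (Nat.le_of_lt_succ h)
      omega
  · intro u hu v hv
    rw [Finset.mem_filter] at hu hv
    exact Nat.lt_succ_of_le (splitLevel_le_iff.2 (by omega))
  · intro u hu v hv
    rw [Finset.mem_filter] at hu hv
    exact Nat.lt_succ_of_le (splitLevel_le_iff.2 (by
      rw [hval u hu.1 hu.2, hval v hv.1 hv.2]))

theorem exists_card_levels_ge (s : ℕ) : ∀ i j : ℕ, i + j = s → ∀ S : Finset ℕ, 2 ^ s ≤ S.card →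
    ∃ v ∈ S, i ≤ (upLevels S v).card ∨ j ≤ (downLevels S v).card := by
  induction s with
  | zero =>
    intro i j hij S hS
    obtain ⟨v, hv⟩ := Finset.card_pos.1 (lt_of_lt_of_le (by norm_num) hS)
    exact ⟨v, hv, Or.inl (by omega)⟩
  | succ s ih =>
    intro i j hij S hS
    have hpos : 0 < 2 ^ s := by positivity
    rw [pow_succ] at hS
    obtain ⟨d, A, hA, B, hB, hc, ⟨a, ha⟩, ⟨b, hb⟩, hAB, hAA, hBB⟩ :=
      exists_splitLevel_partition (S := S) (by omega)
    by_cases hi : i = 0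
    · exact ⟨a, hA ha, Or.inl (by omega)⟩
    by_cases hj : j = 0
    · exact ⟨a, hA ha, Or.inr (by omega)⟩
    rcases le_or_gt (2 ^ s) A.card with h | h
    · obtain ⟨v, hv, h1 | h1⟩ := ih (i - 1) j (by omega) A h
      · refine ⟨v, hA hv, Or.inl ?_⟩
        have hd : d ∉ upLevels A v := by
          intro hd
          obtain ⟨u, hu, hud⟩ := Finset.mem_image.1 hd
          have := hAA v hv u (Finset.mem_filter.1 hu).1
          omega
        have hsub : insert d (upLevels A v) ⊆ upLevels S v := by
          refine Finset.insert_subset ?_ (upLevels_mono hA v)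
          have := hAB v hv b hb
          exact Finset.mem_image.2 ⟨b, Finset.mem_filter.2 ⟨hB hb, this.1⟩, this.2⟩
        have := Finset.card_le_card hsub
        rw [Finset.card_insert_of_notMem hd] at this
        omega
      · exact ⟨v, hA hv, Or.inr (h1.trans (Finset.card_le_card (downLevels_mono hA v)))⟩
    · obtain ⟨v, hv, h1 | h1⟩ := ih i (j - 1) (by omega) B (by omega)
      · exact ⟨v, hB hv, Or.inl (h1.trans (Finset.card_le_card (upLevels_mono hB v)))⟩
      · refine ⟨v, hB hv, Or.inr ?_⟩
        have hd : d ∉ downLevels B v := by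
          intro hd
          obtain ⟨u, hu, hud⟩ := Finset.mem_image.1 hd
          have := hBB u (Finset.mem_filter.1 hu).1 v hv
          omega
        have hsub : insert d (downLevels B v) ⊆ downLevels S v := by
          refine Finset.insert_subset ?_ (downLevels_mono hB v)
          have := hAB a ha v hv
          exact Finset.mem_image.2 ⟨a, Finset.mem_filter.2 ⟨hA ha, this.1⟩, this.2⟩
        have := Finset.card_le_card hsub
        rw [Finset.card_insert_of_notMem hd] at this
        omega

/-- A triple of levels is red if it is monotone and red in `φ` after sorting. -/
def MonotoneRed (φ : ℕ → ℕ → ℕ → Prop) (x y z : ℕ) : Prop :=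
  (x < y ∧ y < z ∧ φ x y z) ∨ (z < y ∧ y < x ∧ φ z y x)

/-- No four points `a < b < c < d` carry the red triple `bcd` together with two further red
triples. -/
def TopSparse (φ : ℕ → ℕ → ℕ → Prop) : Prop :=
  ∀ a b c d, a < b → b < c → c < d → φ b c d →
    ¬ (φ a b c ∧ φ a b d) ∧ ¬ (φ a b c ∧ φ a c d) ∧ ¬ (φ a b d ∧ φ a c d)

open Classical in
/-- The stepping-up colouring of quadruples induced by `φ`. -/
noncomputable def stepUpColoring (φ : ℕ → ℕ → ℕ → Prop) (e : Finset ℕ) : Bool :=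
  decide (∃ a b c d, a < b ∧ b < c ∧ c < d ∧ e = {a, b, c, d} ∧
    MonotoneRed φ (splitLevel a b) (splitLevel b c) (splitLevel c d))

theorem sorted_quadruple_ext {a b c d a' b' c' d' : ℕ} (hab : a < b) (hbc : b < c) (hcd : c < d)
    (hab' : a' < b') (hbc' : b' < c') (hcd' : c' < d')
    (h : ({a, b, c, d} : Finset ℕ) = {a', b', c', d'}) :
    a = a' ∧ b = b' ∧ c = c' ∧ d = d' := by
  have h1 : ∀ x, (x = a ∨ x = b ∨ x = c ∨ x = d) ↔ (x = a' ∨ x = b' ∨ x = c' ∨ x = d') := by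
    intro x
    have := Finset.ext_iff.1 h x
    simpa using this
  have ha := (h1 a).1 (by simp)
  have hb := (h1 b).1 (by simp)
  have hc := (h1 c).1 (by simp)
  have hd := (h1 d).1 (by simp)
  have ha' := (h1 a').2 (by simp)
  have hd' := (h1 d').2 (by simp)
  clear h h1
  omega

theorem stepUpColoring_eq_true_iff {φ : ℕ → ℕ → ℕ → Prop} {a b c d : ℕ} (hab : a < b)
    (hbc : b < c) (hcd : c < d) :
    stepUpColoring φ {a, b, c, d} = true ↔
      MonotoneRed φ (splitLevel a b) (splitLevel b c) (splitLevel c d) := by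
  simp only [stepUpColoring, decide_eq_true_iff]
  constructor
  · rintro ⟨a', b', c', d', h1, h2, h3, he, h⟩
    obtain ⟨rfl, rfl, rfl, rfl⟩ := sorted_quadruple_ext hab hbc hcd h1 h2 h3 he
    exact h
  · intro h
    exact ⟨a, b, c, d, hab, hbc, hcd, rfl, h⟩

theorem false_of_pairwise_or {P Q R : Prop} (h : ¬ (P ∧ Q) ∧ ¬ (P ∧ R) ∧ ¬ (Q ∧ R))
    (hPQ : P ∨ Q) (hPR : P ∨ R) (hQR : Q ∨ R) : False := by
  tauto

/-- Among the quadruples of a `5`-set with consecutive splitting levels `x, y, z, w`, two are not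
red. -/
theorem not_pairwise_monotoneRed {φ : ℕ → ℕ → ℕ → Prop} (hφ : TopSparse φ) {x y z w : ℕ}
    (E : Fin 5 → Prop)
    (h₀ : E 0 → MonotoneRed φ y z w) (h₁ : E 1 → MonotoneRed φ (max x y) z w)
    (h₂ : E 2 → MonotoneRed φ x (max y z) w) (h₃ : E 3 → MonotoneRed φ x y (max z w))
    (h₄ : E 4 → MonotoneRed φ x y z) : ¬ ∀ i j, i ≠ j → E i ∨ E j := by
  intro h
  have h01 := h 0 1 (by decide)
  have h34 := h 3 4 (by decide)
  have h23 := h 2 3 (by decide)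
  have h24 := h 2 4 (by decide)
  have h02 := h 0 2 (by decide)
  have h12 := h 1 2 (by decide)
  have h04 := h 0 4 (by decide)
  clear h
  have inc : x < y → y < z → z < w → False := fun a b c => by
    simp only [MonotoneRed, max_eq_right a.le, max_eq_right b.le, max_eq_right c.le, a, b, c,
      a.trans b, b.trans c, a.not_gt, b.not_gt, c.not_gt, false_and, and_false, true_and, or_false,
      (a.trans b).not_gt, (b.trans c).not_gt] at h₀ h₁ h₂ h₃ h₄
    exact false_of_pairwise_or (hφ x y z w a b c (h01.elim h₀ h₁)) (h34.symm.imp h₄ h₃)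
      (h24.symm.imp h₄ h₂) (h23.symm.imp h₃ h₂)
  have dec : y < x → z < y → w < z → False := fun a b c => by
    simp only [MonotoneRed, max_eq_left a.le, max_eq_left b.le, max_eq_left c.le, a, b, c,
      b.trans a, c.trans b, a.not_gt, b.not_gt, c.not_gt, false_and, and_false, true_and, false_or,
      (b.trans a).not_gt, (c.trans b).not_gt] at h₀ h₁ h₂ h₃ h₄
    exact false_of_pairwise_or (hφ w z y x c b a (h34.elim h₃ h₄)) (h01.imp h₀ h₁)
      (h02.imp h₀ h₂) (h12.imp h₁ h₂)
  have mono : ∀ {a b c}, MonotoneRed φ a b c → a < b ∧ b < c ∨ c < b ∧ b < a := by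
    rintro a b c (h | h)
    exacts [Or.inl ⟨h.1, h.2.1⟩, Or.inr ⟨h.1, h.2.1⟩]
  have h₀' := fun e => mono (h₀ e)
  have h₁' := fun e => mono (h₁ e)
  have h₃' := fun e => mono (h₃ e)
  have h₄' := fun e => mono (h₄ e)
  clear h₀ h₁ h₂ h₃ h₄ h23 h24 h02 h12
  rcases h01 with e | e <;> rcases h34 with e' | e' <;> rcases h04 with e'' | e'' <;> grind

theorem exists_sorted_quintuple {S : Finset ℕ} (hS : S.card = 5) :
    ∃ v : Fin 5 → ℕ, StrictMono v ∧ S = {v 0, v 1, v 2, v 3, v 4} := by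
  refine ⟨S.orderEmbOfFin hS, (S.orderEmbOfFin hS).strictMono, ?_⟩
  have h := Finset.image_orderEmbOfFin_univ S hS
  conv_lhs => rw [← h]
  ext x
  simp only [Finset.mem_image, Finset.mem_univ, true_and, Finset.mem_insert, Finset.mem_singleton,
    Fin.exists_fin_succ]
  simp [eq_comm]

theorem card_filter_stepUpColoring_lt {φ : ℕ → ℕ → ℕ → Prop} (hφ : TopSparse φ) {S : Finset ℕ}
    (hS : S.card = 5) :
    ((S.powersetCard 4).filter (fun e => stepUpColoring φ e = true)).card < 4 := by
  by_contra! hcard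
  have hpair : ∀ u ∈ S, ∀ v ∈ S, u ≠ v →
      stepUpColoring φ (S.erase u) = true ∨ stepUpColoring φ (S.erase v) = true := by
    intro u hu v hv huv
    by_contra! hblue
    have hmem : ∀ x ∈ S, S.erase x ∈ S.powersetCard 4 := fun x hx => by
      rw [Finset.mem_powersetCard, Finset.card_erase_of_mem hx, hS]
      exact ⟨Finset.erase_subset _ _, rfl⟩
    have hsub : (S.powersetCard 4).filter (fun e => stepUpColoring φ e = true) ⊆
        ((S.powersetCard 4).erase (S.erase u)).erase (S.erase v) := by
      intro e he
      rw [Finset.mem_filter] at he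
      refine Finset.mem_erase.2 ⟨fun h => hblue.2 (h ▸ he.2),
        Finset.mem_erase.2 ⟨fun h => hblue.1 (h ▸ he.2), he.1⟩⟩
    have hne : S.erase v ≠ S.erase u := fun h => by
      have : u ∈ S.erase v := Finset.mem_erase.2 ⟨huv, hu⟩
      rw [h] at this
      simp at this
    have h1 := Finset.card_le_card hsub
    rw [Finset.card_erase_of_mem (Finset.mem_erase.2 ⟨hne, hmem v hv⟩),
      Finset.card_erase_of_mem (hmem u hu), Finset.card_powersetCard, hS] at h1
    have : Nat.choose 5 4 = 5 := rfl
    omega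
  obtain ⟨v, hv, rfl⟩ := exists_sorted_quintuple hS
  have h01 : v 0 < v 1 := hv (by decide)
  have h12 : v 1 < v 2 := hv (by decide)
  have h23 : v 2 < v 3 := hv (by decide)
  have h34 : v 3 < v 4 := hv (by decide)
  have erase_eq : ∀ (i a b c d : Fin 5), (∀ j, j ≠ i ↔ j = a ∨ j = b ∨ j = c ∨ j = d) →
      ({v 0, v 1, v 2, v 3, v 4} : Finset ℕ).erase (v i) = {v a, v b, v c, v d} := by
    intro i a b c d h
    have himg : ({v 0, v 1, v 2, v 3, v 4} : Finset ℕ) = Finset.univ.image v := by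
      ext x
      simp [Fin.exists_fin_succ, eq_comm]
    have himg' : ({v a, v b, v c, v d} : Finset ℕ) = ({a, b, c, d} : Finset (Fin 5)).image v := by
      simp [Finset.image_insert]
    rw [himg, himg', ← Finset.image_erase hv.injective]
    congr 1
    ext j
    simpa using h j
  refine not_pairwise_monotoneRed hφ (x := splitLevel (v 0) (v 1)) (y := splitLevel (v 1) (v 2))
    (z := splitLevel (v 2) (v 3)) (w := splitLevel (v 3) (v 4))
    (fun i => stepUpColoring φ (({v 0, v 1, v 2, v 3, v 4} : Finset ℕ).erase (v i)) = true)
    ?_ ?_ ?_ ?_ ?_ ?_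
  · intro h
    rwa [erase_eq 0 1 2 3 4 (by decide), stepUpColoring_eq_true_iff h12 h23 h34] at h
  · intro h
    rwa [erase_eq 1 0 2 3 4 (by decide), stepUpColoring_eq_true_iff (h01.trans h12) h23 h34,
      splitLevel_eq_max h01.le h12.le] at h
  · intro h
    rwa [erase_eq 2 0 1 3 4 (by decide), stepUpColoring_eq_true_iff h01 (h12.trans h23) h34,
      splitLevel_eq_max h12.le h23.le] at h
  · intro h
    rwa [erase_eq 3 0 1 2 4 (by decide), stepUpColoring_eq_true_iff h01 h12 (h23.trans h34),
      splitLevel_eq_max h23.le h34.le] at h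
  · intro h
    rwa [erase_eq 4 0 1 2 3 (by decide), stepUpColoring_eq_true_iff h01 h12 h23] at h
  · intro i j hij
    refine hpair _ ?_ _ ?_ (hv.injective.ne hij)
    · fin_cases i <;> simp
    · fin_cases j <;> simp

theorem exists_stepUpColoring_eq_true {φ : ℕ → ℕ → ℕ → Prop} {N m : ℕ}
    (hind : ∀ A ⊆ Finset.range (N + 1), A.card = m → ∃ a ∈ A, ∃ b ∈ A, ∃ c ∈ A,
      a < b ∧ b < c ∧ φ a b c) {T : Finset ℕ} (hT : T ⊆ Finset.range (2 ^ N))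
    (hcard : 2 ^ (2 * m) ≤ T.card) :
    ∃ e ∈ T.powersetCard 4, stepUpColoring φ e = true := by
  have hquad : ∀ {p q r s : ℕ}, p ∈ T → q ∈ T → r ∈ T → s ∈ T → p < q → q < r → r < s →
      MonotoneRed φ (splitLevel p q) (splitLevel q r) (splitLevel r s) →
      ∃ e ∈ T.powersetCard 4, stepUpColoring φ e = true := by
    intro p q r s hp hq hr hs hpq hqr hrs h
    refine ⟨{p, q, r, s}, Finset.mem_powersetCard.2 ⟨?_, ?_⟩,
      (stepUpColoring_eq_true_iff hpq hqr hrs).2 h⟩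
    · simp [Finset.insert_subset_iff, hp, hq, hr, hs]
    · rw [Finset.card_insert_of_notMem, Finset.card_insert_of_notMem, Finset.card_pair hrs.ne] <;>
        simp only [Finset.mem_insert, Finset.mem_singleton, not_or] <;> omega
  obtain ⟨v, hv, h | h⟩ := exists_card_levels_ge (2 * m) m m (by omega) T hcard
  · obtain ⟨A, hA, hAm⟩ := Finset.exists_subset_card_eq h
    have hget : ∀ a ∈ A, ∃ x ∈ T, v < x ∧ splitLevel v x = a := fun a ha => by
      simpa [upLevels, and_assoc] using hA ha
    have hrange : A ⊆ Finset.range (N + 1) := fun a ha => by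
      obtain ⟨x, hx, -, rfl⟩ := hget a ha
      exact Finset.mem_range_succ_iff.2
        (splitLevel_le (Finset.mem_range.1 (hT hv)) (Finset.mem_range.1 (hT hx)))
    obtain ⟨a, ha, b, hb, c, hc, hab, hbc, hφ⟩ := hind A hrange hAm
    have hnext : ∀ {x y a b : ℕ}, v < x → v < y → splitLevel v x = a → splitLevel v y = b →
        a < b → x < y ∧ splitLevel x y = b := by
      intro x y a b hx hy hxa hyb hab
      have hxy : x < y := by
        by_contra! hle
        have := splitLevel_eq_max hy.le hle
        omega
      have := splitLevel_eq_max hx.le hxy.le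
      exact ⟨hxy, by omega⟩
    obtain ⟨x, hx, hvx, hxa⟩ := hget a ha
    obtain ⟨y, hy, hvy, hyb⟩ := hget b hb
    obtain ⟨z, hz, hvz, hzc⟩ := hget c hc
    obtain ⟨hxy, hxyb⟩ := hnext hvx hvy hxa hyb hab
    obtain ⟨hyz, hyzc⟩ := hnext hvy hvz hyb hzc hbc
    refine hquad hv hx hy hz hvx hxy hyz (Or.inl ?_)
    rw [hxa, hxyb, hyzc]
    exact ⟨hab, hbc, hφ⟩
  · obtain ⟨A, hA, hAm⟩ := Finset.exists_subset_card_eq h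
    have hget : ∀ a ∈ A, ∃ x ∈ T, x < v ∧ splitLevel x v = a := fun a ha => by
      simpa [downLevels, and_assoc] using hA ha
    have hrange : A ⊆ Finset.range (N + 1) := fun a ha => by
      obtain ⟨x, hx, -, rfl⟩ := hget a ha
      exact Finset.mem_range_succ_iff.2
        (splitLevel_le (Finset.mem_range.1 (hT hx)) (Finset.mem_range.1 (hT hv)))
    obtain ⟨a, ha, b, hb, c, hc, hab, hbc, hφ⟩ := hind A hrange hAm
    have hnext : ∀ {x y a b : ℕ}, x < v → y < v → splitLevel x v = a → splitLevel y v = b →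
        a < b → y < x ∧ splitLevel y x = b := by
      intro x y a b hx hy hxa hyb hab
      have hxy : y < x := by
        by_contra! hle
        have := splitLevel_eq_max hle hy.le
        omega
      have := splitLevel_eq_max hxy.le hx.le
      exact ⟨hxy, by omega⟩
    obtain ⟨x, hx, hvx, hxa⟩ := hget a ha
    obtain ⟨y, hy, hvy, hyb⟩ := hget b hb
    obtain ⟨z, hz, hvz, hzc⟩ := hget c hc
    obtain ⟨hxy, hxyb⟩ := hnext hvx hvy hxa hyb hab
    obtain ⟨hyz, hyzc⟩ := hnext hvy hvz hyb hzc hbc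
    refine hquad hz hy hx hv hyz hxy hvx (Or.inr ?_)
    rw [hxa, hxyb, hyzc]
    exact ⟨hab, hbc, hφ⟩

/-- The stepping-up bound: a `TopSparse` triple system on `N + 1` points without independent sets
of size `m` forces `ehRamsey 4 4 n > 2 ^ N` for all `n ≥ 4 ^ m`. -/
theorem two_pow_lt_ehRamsey {φ : ℕ → ℕ → ℕ → Prop} (hφ : TopSparse φ) {N m n : ℕ}
    (hind : ∀ A ⊆ Finset.range (N + 1), A.card = m → ∃ a ∈ A, ∃ b ∈ A, ∃ c ∈ A,
      a < b ∧ b < c ∧ φ a b c) (hn : 2 ^ (2 * m) ≤ n) :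
    2 ^ N < ehRamsey 4 4 n := by
  have hne : {N : ℕ | ∀ χ : Finset ℕ → Bool,
      (∃ S ⊆ Finset.range N, S.card = 4 + 1 ∧
        4 ≤ ((S.powersetCard 4).filter (fun e => χ e = true)).card) ∨
      (∃ T ⊆ Finset.range N, T.card = n ∧ ∀ e ∈ T.powersetCard 4, χ e = false)}.Nonempty := by
    obtain ⟨R, hR⟩ := exists_monochromatic_subset 4 (n + 5)
    refine ⟨R, fun χ => ?_⟩
    obtain ⟨T, hTR, hT, col, hcol⟩ := hR χ (Finset.range R) (by simp)
    cases col with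
    | false =>
      obtain ⟨U, hU, hUc⟩ := Finset.exists_subset_card_eq (show n ≤ T.card by omega)
      exact Or.inr ⟨U, hU.trans hTR, hUc, fun e he => hcol e (Finset.powersetCard_mono hU he)⟩
    | true =>
      obtain ⟨U, hU, hUc⟩ := Finset.exists_subset_card_eq (show 5 ≤ T.card by omega)
      refine Or.inl ⟨U, hU.trans hTR, hUc, ?_⟩
      rw [Finset.filter_true_of_mem fun e he => hcol e (Finset.powersetCard_mono hU he),
        Finset.card_powersetCard, hUc]
      decide
  by_contra! hle
  have hmem := Nat.sInf_mem hne
  have hrange : Finset.range (ehRamsey 4 4 n) ⊆ Finset.range (2 ^ N) :=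
    Finset.range_subset_range.2 hle
  rcases hmem (stepUpColoring φ) with ⟨S, -, hS, h4⟩ | ⟨T, hT, hTn, hblue⟩
  · exact absurd h4 (not_le.2 (card_filter_stepUpColoring_lt hφ hS))
  · obtain ⟨e, he, hred⟩ := exists_stepUpColoring_eq_true hind (hT.trans hrange) (hTn ▸ hn)
    rw [hblue e he] at hred
    exact absurd hred (by simp)

/-- The oriented graph on the affine plane joining `u` to the points of the parabola with
vertex `u`. -/
def ParabolaAdj {p : ℕ} (u v : ZMod p × ZMod p) : Prop :=
  v.2 - u.2 = (v.1 - u.1) ^ 2 ∧ v.1 ≠ u.1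

theorem two_ne_zero_zmod {p : ℕ} [Fact p.Prime] (hp : p ≠ 2) : (2 : ZMod p) ≠ 0 := by
  intro h
  have h' : ((2 : ℕ) : ZMod p) = 0 := by exact_mod_cast h
  rw [ZMod.natCast_eq_zero_iff] at h'
  exact hp ((Nat.prime_dvd_prime_iff_eq Fact.out Nat.prime_two).1 h')

theorem not_parabolaAdj_of_transitive {p : ℕ} [Fact p.Prime] (hp : p ≠ 2) {u v w : ZMod p × ZMod p}
    (huv : ParabolaAdj u v) (hvw : ParabolaAdj v w) : ¬ ParabolaAdj u w := by
  intro huw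
  have htwo := two_ne_zero_zmod hp
  have h : 2 * ((v.1 - u.1) * (w.1 - v.1)) = 0 := by
    linear_combination huv.1 + hvw.1 - huw.1
  rcases mul_eq_zero.1 ((mul_eq_zero.1 h).resolve_left htwo) with h | h
  · exact huv.2 (sub_eq_zero.1 h)
  · exact hvw.2 (sub_eq_zero.1 h)

section Parabola

variable {p : ℕ} [Fact p.Prime]

open Classical in
/-- The points whose parabola passes through `v`. -/
noncomputable def parabolaFiber (X : Finset (ZMod p × ZMod p)) (v : ZMod p × ZMod p) :
    Finset (ZMod p × ZMod p) :=
  X.filter fun x => v.2 - x.2 = (v.1 - x.1) ^ 2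

theorem sum_card_parabolaFiber (X : Finset (ZMod p × ZMod p)) :
    ∑ v, (parabolaFiber X v).card = p * X.card := by
  classical
  simp only [parabolaFiber, Finset.card_filter]
  rw [Finset.sum_comm]
  have : ∀ x ∈ X, (∑ v : ZMod p × ZMod p, if v.2 - x.2 = (v.1 - x.1) ^ 2 then 1 else 0) = p := by
    intro x _
    rw [← Finset.card_filter]
    have : (Finset.univ.filter fun v : ZMod p × ZMod p => v.2 - x.2 = (v.1 - x.1) ^ 2) =
        Finset.univ.image fun a : ZMod p => (a, x.2 + (a - x.1) ^ 2) := by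
      ext ⟨a, b⟩
      simp [sub_eq_iff_eq_add', eq_comm]
    rw [this, Finset.card_image_of_injective _ (fun a b h => (Prod.ext_iff.1 h).1)]
    simp [ZMod.card]
  rw [Finset.sum_congr rfl this]
  simp [mul_comm]

theorem sum_card_parabolaFiber_sq_le (hp : p ≠ 2) (X : Finset (ZMod p × ZMod p)) :
    ∑ v, (parabolaFiber X v).card ^ 2 ≤ p * X.card + X.card ^ 2 := by
  classical
  have htwo := two_ne_zero_zmod hp
  have hsq : ∀ v, (parabolaFiber X v).card ^ 2 = (parabolaFiber X v).card +
      ((X ×ˢ X).filter fun q => q.1 ≠ q.2 ∧ v.2 - q.1.2 = (v.1 - q.1.1) ^ 2 ∧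
        v.2 - q.2.2 = (v.1 - q.2.1) ^ 2).card := by
    intro v
    have h1 := Finset.offDiag_card (parabolaFiber X v)
    have h2 : (parabolaFiber X v).offDiag = (X ×ˢ X).filter fun q => q.1 ≠ q.2 ∧
        v.2 - q.1.2 = (v.1 - q.1.1) ^ 2 ∧ v.2 - q.2.2 = (v.1 - q.2.1) ^ 2 := by
      ext q
      simp only [Finset.mem_offDiag, parabolaFiber, Finset.mem_filter, Finset.mem_product]
      tauto
    rw [← h2, h1, sq]
    have := Nat.le_mul_self (parabolaFiber X v).card
    omega
  rw [Finset.sum_congr rfl fun v _ => hsq v, Finset.sum_add_distrib, sum_card_parabolaFiber]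
  refine Nat.add_le_add_left ?_ _
  simp only [Finset.card_filter]
  rw [Finset.sum_comm]
  calc _ ≤ ∑ q ∈ X ×ˢ X, 1 := Finset.sum_le_sum fun q _ => ?_
    _ = X.card ^ 2 := by simp [sq]
  rw [← Finset.card_filter, Finset.card_le_one]
  rintro ⟨a, b⟩ hv ⟨a', b'⟩ hv'
  simp only [Finset.mem_filter, Finset.mem_univ, true_and] at hv hv'
  obtain ⟨hne, h1, h2⟩ := hv
  obtain ⟨-, h1', h2'⟩ := hv'
  have hfst : q.1.1 ≠ q.2.1 := by
    intro h
    refine hne (Prod.ext h ?_)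
    rw [h] at h1
    linear_combination h2 - h1
  have ha : a = a' := by
    have : 2 * ((q.1.1 - q.2.1) * (a - a')) = 0 := by
      linear_combination h1 - h2 - (h1' - h2')
    rcases mul_eq_zero.1 ((mul_eq_zero.1 this).resolve_left htwo) with h | h
    · exact absurd (sub_eq_zero.1 h) hfst
    · exact sub_eq_zero.1 h
  subst ha
  refine Prod.ext rfl ?_
  linear_combination h1 - h1'

theorem sum_sq_parabolaFiber_le (hp : p ≠ 2) (X : Finset (ZMod p × ZMod p)) :
    ∑ v, ((p : ℤ) * (parabolaFiber X v).card - X.card) ^ 2 ≤ p ^ 3 * X.card := by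
  have h1 : ∑ v, ((parabolaFiber X v).card : ℤ) = p * X.card := by
    exact_mod_cast sum_card_parabolaFiber X
  have h2 : ∑ v, ((parabolaFiber X v).card : ℤ) ^ 2 ≤ p * X.card + X.card ^ 2 := by
    exact_mod_cast sum_card_parabolaFiber_sq_le hp X
  have h3 : ∑ v, ((p : ℤ) * (parabolaFiber X v).card - X.card) ^ 2 =
      p ^ 2 * ∑ v, ((parabolaFiber X v).card : ℤ) ^ 2 -
      2 * p * X.card * ∑ v, ((parabolaFiber X v).card : ℤ) + p ^ 2 * X.card ^ 2 := by
    have : ∀ v, ((p : ℤ) * (parabolaFiber X v).card - X.card) ^ 2 =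
      p ^ 2 * ((parabolaFiber X v).card : ℤ) ^ 2 -
      2 * p * X.card * ((parabolaFiber X v).card : ℤ) + X.card ^ 2 := fun v => by ring
    simp only [this, Finset.sum_add_distrib, Finset.sum_sub_distrib, ← Finset.mul_sum]
    rw [Finset.sum_const, Finset.card_univ, Fintype.card_prod, ZMod.card, nsmul_eq_mul]
    push_cast
    ring
  rw [h3, h1]
  nlinarith [mul_le_mul_of_nonneg_left h2 (sq_nonneg (p : ℤ))]

/-- Expansion of the parabola graph: large sets span an edge. -/
theorem exists_parabolaAdj (hp : p ≠ 2) {X Y : Finset (ZMod p × ZMod p)} (hX : 2 * p ≤ X.card)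
    (hXY : 4 * p ^ 3 < X.card * Y.card) : ∃ x ∈ X, ∃ y ∈ Y, ParabolaAdj x y := by
  classical
  by_contra! hno
  have hone : ∀ v ∈ Y, (parabolaFiber X v).card ≤ 1 := by
    intro v hv
    refine Finset.card_le_one.2 ?_
    have : ∀ x ∈ parabolaFiber X v, x = v := by
      intro x hx
      obtain ⟨hx, h⟩ := Finset.mem_filter.1 hx
      by_cases hxv : v.1 = x.1
      · refine Prod.ext hxv.symm ?_
        rw [hxv, sub_self] at h
        linear_combination -h
      · exact absurd ⟨h, hxv⟩ (hno x hx v hv)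
    intro a ha b hb
    rw [this a ha, this b hb]
  have hle : (Y.card : ℤ) * X.card ^ 2 ≤ 4 * (p ^ 3 * X.card) := by
    calc (Y.card : ℤ) * X.card ^ 2 = ∑ v ∈ Y, (X.card : ℤ) ^ 2 := by simp
      _ ≤ ∑ v ∈ Y, 4 * ((p : ℤ) * (parabolaFiber X v).card - X.card) ^ 2 :=
          Finset.sum_le_sum fun v hv => by
            have h1 : ((parabolaFiber X v).card : ℤ) ≤ 1 := by exact_mod_cast hone v hv
            have h2 : 2 * (p : ℤ) ≤ X.card := by exact_mod_cast hX
            have h3 : (p : ℤ) * (parabolaFiber X v).card ≤ p := by nlinarith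
            nlinarith
      _ ≤ ∑ v, 4 * ((p : ℤ) * (parabolaFiber X v).card - X.card) ^ 2 :=
          Finset.sum_le_sum_of_subset_of_nonneg (Finset.subset_univ _)
            fun _ _ _ => by positivity
      _ ≤ 4 * (p ^ 3 * X.card) := by
          rw [← Finset.mul_sum]
          exact mul_le_mul_of_nonneg_left (sum_sq_parabolaFiber_le hp X) (by norm_num)
  have hpos : 0 < (X.card : ℤ) := by
    have := (Fact.out : p.Prime).pos
    omega
  have hlt : 4 * (p : ℤ) ^ 3 < X.card * Y.card := by exact_mod_cast hXY
  nlinarith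

end Parabola

section Expansion

variable {Λ : Type*} [Fintype Λ]

/-- Every two sets of density at least `w⁻²` span an edge of `H`. -/
def IsExpanding (H : Λ → Λ → Prop) (w : ℕ) : Prop :=
  ∀ X Y : Finset Λ, Fintype.card Λ ≤ w ^ 2 * X.card → Fintype.card Λ ≤ w ^ 2 * Y.card →
    ∃ x ∈ X, ∃ y ∈ Y, H x y

open Classical in
/-- The row of `V` above `a`. -/
noncomputable def pairRow (V : Finset (Λ × Λ)) (a : Λ) : Finset Λ :=
  Finset.univ.filter fun b => (a, b) ∈ V

theorem mem_pairRow {V : Finset (Λ × Λ)} {a b : Λ} : b ∈ pairRow V a ↔ (a, b) ∈ V := by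
  simp [pairRow]

theorem sum_card_pairRow (V : Finset (Λ × Λ)) : ∑ a, (pairRow V a).card = V.card := by
  classical
  rw [Finset.card_eq_sum_card_fiberwise (f := Prod.fst) (t := Finset.univ) (by simp)]
  refine Finset.sum_congr rfl fun a _ => ?_
  refine Finset.card_bij (fun b _ => (a, b)) ?_ ?_ ?_
  · intro b hb
    simpa using mem_pairRow.1 hb
  · intro b _ c _ h
    exact (Prod.ext_iff.1 h).2
  · rintro ⟨a', b⟩ h
    simp only [Finset.mem_filter] at h
    obtain ⟨h, rfl⟩ := h
    exact ⟨b, mem_pairRow.2 h, rfl⟩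

theorem card_le_mul_card_rich_rows {w : ℕ} (hΛ : 0 < Fintype.card Λ) {V : Finset (Λ × Λ)}
    (hV : 2 * Fintype.card Λ ^ 2 ≤ w ^ 2 * V.card) :
    Fintype.card Λ ≤ w ^ 2 *
      (Finset.univ.filter fun a => Fintype.card Λ ≤ w ^ 2 * (pairRow V a).card).card := by
  classical
  set l := Fintype.card Λ
  by_contra! hlt
  set P := Finset.univ.filter fun a => l ≤ w ^ 2 * (pairRow V a).card
  have h1 : w ^ 2 * V.card ≤ ∑ a, ((if a ∈ P then w ^ 2 * l else 0) + l) := by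
    rw [← sum_card_pairRow, Finset.mul_sum]
    refine Finset.sum_le_sum fun a _ => ?_
    split_ifs with h
    · exact (Nat.mul_le_mul_left _ (Finset.card_le_univ _)).trans (Nat.le_add_right _ _)
    · have : ¬ l ≤ w ^ 2 * (pairRow V a).card := fun h' => h (by simpa [P] using h')
      omega
  rw [Finset.sum_add_distrib, Finset.sum_ite_mem, Finset.univ_inter, Finset.sum_const,
    Finset.sum_const, Finset.card_univ, smul_eq_mul, smul_eq_mul] at h1
  change _ ≤ _ + l * l at h1
  nlinarith

open Classical in
theorem card_filter_forall_not_lt {H : Λ → Λ → Prop} {w : ℕ} (hH : IsExpanding H w)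
    (hΛ : 0 < Fintype.card Λ) {V : Finset (Λ × Λ)}
    (hV : 2 * Fintype.card Λ ^ 2 ≤ w ^ 2 * V.card) :
    w ^ 2 * (Finset.univ.filter fun z : Λ × Λ => ∀ v ∈ V, ¬ (H v.1 z.1 ∧ H z.2 v.2)).card <
      2 * Fintype.card Λ ^ 2 := by
  by_contra! hZ
  obtain ⟨a, ha, b, hb, hab⟩ := hH _ _ (card_le_mul_card_rich_rows hΛ hV)
    (card_le_mul_card_rich_rows hΛ hZ)
  simp only [Finset.mem_filter, Finset.mem_univ, true_and] at ha hb
  obtain ⟨z, hz, v, hv, hzv⟩ := hH _ _ hb ha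
  have hz' := mem_pairRow.1 hz
  simp only [Finset.mem_filter, Finset.mem_univ, true_and] at hz'
  exact hz' (a, v) (mem_pairRow.1 hv) hab hzv

open Classical in
theorem card_filter_forall_mem_le {H : Λ → Λ → Prop} {w : ℕ} (hH : IsExpanding H w)
    {V Y : Finset (Λ × Λ)} (hV : w ^ 2 * V.card < 2 * Fintype.card Λ ^ 2)
    (hY : 8 * Fintype.card Λ ^ 2 < w * Y.card) :
    w * (Finset.univ.filter fun x : Λ × Λ => ∀ y ∈ Y, H x.2 y.1 → (x.1, y.2) ∈ V).card ≤
      3 * Fintype.card Λ ^ 2 := by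
  set l := Fintype.card Λ
  set F := Finset.univ.filter fun x : Λ × Λ => ∀ y ∈ Y, H x.2 y.1 → (x.1, y.2) ∈ V
  have hl : 0 < l := by
    rcases Nat.eq_zero_or_pos l with h | h
    · simp [h] at hV
    · exact h
  have hw : 0 < w := by
    rcases Nat.eq_zero_or_pos w with h | h
    · simp [h] at hY
    · exact h
  have hlight : ∀ a, w * (pairRow V a).card < l → w * (pairRow F a).card ≤ l := by
    intro a ha
    set Y' := Y.filter fun y => y.2 ∉ pairRow V a
    have hsub : Y ⊆ Y' ∪ Finset.univ ×ˢ pairRow V a := by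
      intro y hy
      by_cases h : y.2 ∈ pairRow V a <;> simp [Y', hy, h]
    have hYle : Y.card ≤ Y'.card + l * (pairRow V a).card := by
      refine (Finset.card_le_card hsub).trans ((Finset.card_union_le _ _).trans ?_)
      rw [Finset.card_product, Finset.card_univ]
    have hYle' : Y'.card ≤ (Y'.image Prod.fst).card * l := by
      have : Y' ⊆ Y'.image Prod.fst ×ˢ Finset.univ := fun y hy =>
        Finset.mem_product.2 ⟨Finset.mem_image_of_mem _ hy, Finset.mem_univ _⟩
      refine (Finset.card_le_card this).trans ?_
      rw [Finset.card_product, Finset.card_univ]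
    have hproj : l ≤ w ^ 2 * (Y'.image Prod.fst).card := by
      have h1 : 7 * l ^ 2 < w * ((Y'.image Prod.fst).card * l) := by nlinarith
      have h2 : l < w * (Y'.image Prod.fst).card := by nlinarith
      nlinarith
    by_contra! hlt
    obtain ⟨x, hx, b, hb, hxb⟩ := hH (pairRow F a) (Y'.image Prod.fst) (by nlinarith) hproj
    obtain ⟨y, hy, rfl⟩ := Finset.mem_image.1 hb
    obtain ⟨hyY, hyV⟩ := Finset.mem_filter.1 hy
    have hxF := mem_pairRow.1 hx
    simp only [F, Finset.mem_filter, Finset.mem_univ, true_and] at hxF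
    exact hyV (mem_pairRow.2 (hxF y hyY hxb))
  have hrow : ∀ a, w * (pairRow F a).card ≤ w ^ 2 * (pairRow V a).card + l := by
    intro a
    rcases lt_or_ge (w * (pairRow V a).card) l with h | h
    · exact (hlight a h).trans (Nat.le_add_left _ _)
    · have : (pairRow F a).card ≤ l := Finset.card_le_univ _
      nlinarith
  calc w * F.card = ∑ a, w * (pairRow F a).card := by rw [← sum_card_pairRow, Finset.mul_sum]
    _ ≤ ∑ a, (w ^ 2 * (pairRow V a).card + l) := Finset.sum_le_sum fun a _ => hrow a
    _ = w ^ 2 * V.card + l * l := by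
        rw [Finset.sum_add_distrib, ← Finset.mul_sum, sum_card_pairRow, Finset.sum_const,
          Finset.card_univ, smul_eq_mul]
    _ ≤ 3 * l ^ 2 := by nlinarith

end Expansion

theorem isExpanding_parabolaAdj {p w : ℕ} [Fact p.Prime] (hp : p ≠ 2) (hw : 4 * w ^ 4 < p) :
    IsExpanding (ParabolaAdj (p := p)) w := by
  intro X Y hX hY
  have hp0 : 0 < p := (Fact.out : p.Prime).pos
  simp only [Fintype.card_prod, ZMod.card] at hX hY
  rcases Nat.eq_zero_or_pos w with rfl | hw0
  · simp at hX
    omega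
  refine exists_parabolaAdj hp ?_ ?_
  · have h1 : 4 * w ^ 2 ≤ p := by nlinarith [Nat.pow_le_pow_right hw0 (show 2 ≤ 4 by norm_num)]
    have : w ^ 2 * (4 * p) ≤ w ^ 2 * X.card := by nlinarith
    have := Nat.le_of_mul_le_mul_left this (by positivity)
    omega
  · have h1 : p ^ 4 ≤ w ^ 4 * (X.card * Y.card) := by
      calc p ^ 4 = (p * p) * (p * p) := by ring
        _ ≤ (w ^ 2 * X.card) * (w ^ 2 * Y.card) := Nat.mul_le_mul hX hY
        _ = _ := by ring
    have h2 : w ^ 4 * (4 * p ^ 3) < p ^ 4 := by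
      calc w ^ 4 * (4 * p ^ 3) = (4 * w ^ 4) * p ^ 3 := by ring
        _ < p * p ^ 3 := Nat.mul_lt_mul_of_pos_right hw (by positivity)
        _ = p ^ 4 := by ring
    exact Nat.lt_of_mul_lt_mul_left (h2.trans_le h1)

section Density

variable {Ω α β ι : Type*} [Fintype Ω] [Fintype α] [Fintype β]

open Classical in
/-- The probability of an event under the uniform distribution. -/
noncomputable def density (P : Ω → Prop) : ℝ :=
  ((Finset.univ.filter P).card : ℝ) / Fintype.card Ω

theorem density_eq (P : Ω → Prop) [DecidablePred P] :
    density P = ((Finset.univ.filter P).card : ℝ) / Fintype.card Ω := by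
  unfold density
  congr

theorem density_nonneg (P : Ω → Prop) : 0 ≤ density P := by
  unfold density; positivity

theorem density_mono {P Q : Ω → Prop} (h : ∀ ω, P ω → Q ω) : density P ≤ density Q := by
  classical
  simp only [density_eq]
  gcongr
  exact h _

theorem density_le_one (P : Ω → Prop) : density P ≤ 1 := by
  classical
  simp only [density_eq]
  refine div_le_one_of_le₀ ?_ (by positivity)
  exact_mod_cast Finset.card_le_univ _

theorem density_false : density (fun _ : Ω => False) = 0 := by
  simp [density]

theorem density_or_le (P Q : Ω → Prop) :
    density (fun ω => P ω ∨ Q ω) ≤ density P + density Q := by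
  classical
  simp only [density_eq]
  rw [← add_div, Finset.filter_or]
  gcongr
  exact_mod_cast Finset.card_union_le _ _

theorem density_exists_mem_le (s : Finset ι) {P : ι → Ω → Prop} {ε : ℝ}
    (h : ∀ i ∈ s, density (P i) ≤ ε) : density (fun ω => ∃ i ∈ s, P i ω) ≤ s.card * ε := by
  classical
  calc density (fun ω => ∃ i ∈ s, P i ω) ≤ ∑ i ∈ s, density (P i) := by
        simp only [density_eq]
        rw [← Finset.sum_div]
        gcongr
        have : (Finset.univ.filter fun ω => ∃ i ∈ s, P i ω) =
            s.biUnion fun i => Finset.univ.filter (P i) := by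
          ext ω
          simp
        rw [this]
        exact_mod_cast Finset.card_biUnion_le
    _ ≤ s.card * ε := by simpa using Finset.sum_le_card_nsmul s _ ε h

variable [Fintype ι]

theorem density_exists_le {C : ι → Prop} {P : ι → Ω → Prop} {ε : ℝ} (hε : 0 ≤ ε)
    (h : ∀ i, C i → density (P i) ≤ ε) :
    density (fun ω => ∃ i, C i ∧ P i ω) ≤ Fintype.card ι * ε := by
  classical
  refine (density_mono fun ω ⟨i, hi, hP⟩ =>
    ⟨i, Finset.mem_filter.2 ⟨Finset.mem_univ _, hi⟩, hP⟩).trans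
    ((density_exists_mem_le (Finset.univ.filter C) fun i hi => h i (by simpa using hi)).trans ?_)
  gcongr
  exact Finset.card_le_univ _

theorem density_comp_equiv (e : α ≃ β) (P : β → Prop) : density (fun a => P (e a)) = density P := by
  classical
  simp only [density_eq]
  rw [Fintype.card_congr e]
  congr 2
  exact Finset.card_bij (fun a _ => e a) (by simp) (fun a _ b _ h => e.injective h)
    fun b hb => ⟨e.symm b, by simpa using hb, by simp⟩

theorem density_prod_le {P : α × β → Prop} {ε : ℝ} (hε : 0 ≤ ε)
    (h : ∀ a, density (fun b => P (a, b)) ≤ ε) : density P ≤ ε := by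
  classical
  rcases isEmpty_or_nonempty (α × β) with hE | hE
  · simpa [density] using hε
  have hcard : (Finset.univ.filter P).card =
      ∑ a, (Finset.univ.filter fun b => P (a, b)).card := by
    simp only [Finset.card_filter]
    exact Fintype.sum_prod_type _
  obtain ⟨a₀, b₀⟩ := hE
  have hβ : 0 < (Fintype.card β : ℝ) := by exact_mod_cast Fintype.card_pos_iff.2 ⟨b₀⟩
  have hα : 0 < (Fintype.card α : ℝ) := by exact_mod_cast Fintype.card_pos_iff.2 ⟨a₀⟩
  simp only [density_eq] at h ⊢
  rw [hcard, Fintype.card_prod, div_le_iff₀ (by push_cast; positivity)]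
  push_cast
  calc ∑ a, ((Finset.univ.filter fun b => P (a, b)).card : ℝ)
      ≤ ∑ _a : α, ε * Fintype.card β :=
        Finset.sum_le_sum fun a _ => (div_le_iff₀ hβ).1 (h a)
    _ = ε * (Fintype.card α * Fintype.card β) := by
        rw [Finset.sum_const, Finset.card_univ, nsmul_eq_mul]; ring

theorem density_prod_le' {P : α × β → Prop} {ε : ℝ} (hε : 0 ≤ ε)
    (h : ∀ b, density (fun a => P (a, b)) ≤ ε) : density P ≤ ε := by
  rw [← density_comp_equiv (Equiv.prodComm β α)]
  exact density_prod_le hε h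

variable [DecidableEq ι]

theorem density_pi (P : ι → α → Prop) :
    density (fun h : ι → α => ∀ i, P i (h i)) = ∏ i, density (P i) := by
  classical
  simp only [density_eq]
  rw [Finset.prod_div_distrib, Finset.prod_const, Fintype.card_fun, Finset.card_univ]
  have : (Finset.univ.filter fun h : ι → α => ∀ i, P i (h i)) =
      Fintype.piFinset fun i => Finset.univ.filter (P i) := by
    ext h
    simp
  rw [this, Fintype.card_piFinset]
  push_cast
  rfl

theorem density_forall_mem_le {P : ι → α → Prop} {I : Finset ι} {ε : ℝ}
    (h : ∀ i ∈ I, density (P i) ≤ ε) :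
    density (fun h : ι → α => ∀ i ∈ I, P i (h i)) ≤ ε ^ I.card := by
  rw [density_pi fun i a => i ∈ I → P i a, ← Finset.prod_const, ← Finset.univ_inter I,
    ← Finset.prod_ite_mem]
  refine Finset.prod_le_prod (fun i _ => density_nonneg _) fun i _ => ?_
  split_ifs with hi
  · exact (density_mono fun a ha => ha (by simpa using hi)).trans (h i hi)
  · exact density_le_one _

open Classical in
theorem density_card_ge_le {P : ι → α → Prop} {ε : ℝ} (hε : 0 ≤ ε)
    (h : ∀ i, density (P i) ≤ ε) (s : ℕ) :
    density (fun h : ι → α => s ≤ (Finset.univ.filter fun i => P i (h i)).card) ≤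
      2 ^ Fintype.card ι * ε ^ s := by
  calc _ ≤ density (fun h : ι → α => ∃ I ∈ Finset.powersetCard s (Finset.univ : Finset ι),
          ∀ i ∈ I, P i (h i)) := density_mono fun h hs => by
        obtain ⟨I, hI, hIs⟩ := Finset.exists_subset_card_eq hs
        exact ⟨I, Finset.mem_powersetCard.2 ⟨Finset.subset_univ _, hIs⟩,
          fun i hi => by simpa using hI hi⟩
    _ ≤ (Finset.powersetCard s (Finset.univ : Finset ι)).card * ε ^ s :=
        density_exists_mem_le _ fun I hI => by
          rw [← (Finset.mem_powersetCard.1 hI).2]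
          exact density_forall_mem_le fun i _ => h i
    _ ≤ 2 ^ Fintype.card ι * ε ^ s := by
        gcongr
        rw [Finset.card_powersetCard]
        exact_mod_cast Nat.choose_le_two_pow _ _

theorem density_comp_injective_le {κ : Type*} [Fintype κ] [DecidableEq κ] {f : ι → κ}
    (hf : Function.Injective f) (P : (ι → α) → Prop) :
    density (fun h : κ → α => P (h ∘ f)) ≤ density P := by
  classical
  let e : ι ⊕ {x // x ∉ Set.range f} ≃ κ :=
    (Equiv.sumCongr (Equiv.ofInjective f hf) (Equiv.refl _)).trans
      (Equiv.sumCompl fun x => x ∈ Set.range f)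
  have he : ∀ i, e (Sum.inl i) = f i := fun i => by simp [e]
  let E : (κ → α) ≃ (ι → α) × ({x // x ∉ Set.range f} → α) :=
    (Equiv.arrowCongr e.symm (Equiv.refl α)).trans (Equiv.sumArrowEquivProdArrow _ _ _)
  have hE : ∀ h, (E h).1 = h ∘ f := fun h => by
    ext i
    simp [E, ← he, Equiv.sumArrowEquivProdArrow]
  have : (fun h : κ → α => P (h ∘ f)) = fun h => (fun q : _ × _ => P q.1) (E h) := by
    ext h
    simp only [hE]
  rw [this, density_comp_equiv E fun q => P q.1]
  exact density_prod_le' (density_nonneg _) fun b => le_rfl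

end Density

section Counting

variable {Γ J κ ι : Type*} [Fintype Γ] [Fintype J] [Fintype κ] [Fintype ι]

/-- A set of density more than `β`. -/
def IsBig (β : ℝ) (Y : Finset Γ) : Prop :=
  β * Fintype.card Γ < Y.card

/-- The relations `Q`, `T` on colors and the operation `ρ` are `β`-mixing relative to a notion of
small sets of colors. -/
structure IsMixing (β : ℝ) (Q T : Γ → Γ → Prop) (ρ : Γ → Γ → Γ) (small : Finset Γ → Prop) :
    Prop where
  avoid : ∀ V, ¬ small V → density (fun z => ∀ v ∈ V, ¬ T v z) ≤ β
  confine : ∀ V Y, small V → IsBig β Y → density (fun x => ∀ y ∈ Y, Q x y → ρ x y ∈ V) ≤ β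

open Classical in
/-- The values `ρ (ψ b) y` forced by the color lists `Y b`, `b ∈ R`. -/
noncomputable def forcedColors (Q : Γ → Γ → Prop) (ρ : Γ → Γ → Γ) (ψ : ι → Γ) (R : Finset ι)
    (Y : ι → Finset Γ) : Finset Γ :=
  Finset.univ.filter fun v => ∃ b ∈ R, ∃ y ∈ Y b, Q (ψ b) y ∧ ρ (ψ b) y = v

/-- At least `r` of the color lists are big. -/
def IsRich (β : ℝ) (r : ℕ) (q : Finset ι × (ι → Finset Γ)) : Prop :=
  r ≤ q.1.card ∧ ∀ b ∈ q.1, IsBig β (q.2 b)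

open Classical in
/-- Some rich system of color lists forces only few colors at `s` or more of the rows of `φ`. -/
def ChunkBad (β : ℝ) (r s : ℕ) (Q : Γ → Γ → Prop) (ρ : Γ → Γ → Γ) (small : Finset Γ → Prop)
    (φ : κ → ι → Γ) : Prop :=
  ∃ q : Finset ι × (ι → Finset Γ), IsRich β r q ∧
    s ≤ (Finset.univ.filter fun a => small (forcedColors Q ρ (φ a) q.1 q.2)).card

/-- The column `γ` avoids all colors forced by a rich system of color lists on a good chunk. -/
def ColumnBad (β : ℝ) (r s : ℕ) (Q T : Γ → Γ → Prop) (ρ : Γ → Γ → Γ) (small : Finset Γ → Prop)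
    (f : J → κ → ι → Γ) (γ : κ → Γ) : Prop :=
  ∃ q : J × Finset ι × (ι → Finset Γ),
    (¬ ChunkBad β r s Q ρ small (f q.1) ∧ IsRich β r q.2) ∧
      ∀ a, ∀ b ∈ q.2.1, ∀ y ∈ q.2.2 b, ¬ (Q (f q.1 a b) y ∧ T (ρ (f q.1 a b) y) (γ a))

variable {β : ℝ} {r s : ℕ} {Q T : Γ → Γ → Prop} {ρ : Γ → Γ → Γ} {small : Finset Γ → Prop}

open Classical in
/-- The colors `y` with no red triple `(φ a, y, γ a)`. -/
noncomputable def compatibleColors (Q T : Γ → Γ → Prop) (ρ : Γ → Γ → Γ) (φ γ : κ → Γ) :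
    Finset Γ :=
  Finset.univ.filter fun y => ∀ a, ¬ (Q (φ a) y ∧ T (ρ (φ a) y) (γ a))

open Classical in
theorem card_filter_triple_le {big : J → κ → ι → Prop} {badJ : J → Prop} {badκ : κ → Prop}
    (hbig : ∀ j c, ¬ badJ j → ¬ badκ c → (Finset.univ.filter (big j c)).card ≤ r) :
    (Finset.univ.filter fun q : J × κ × ι => big q.1 q.2.1 q.2.2).card ≤
      Fintype.card J * Fintype.card κ * r +
        (Finset.univ.filter badJ).card * Fintype.card κ * Fintype.card ι +
        Fintype.card J * (Finset.univ.filter badκ).card * Fintype.card ι := by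
  have hsum : (Finset.univ.filter fun q : J × κ × ι => big q.1 q.2.1 q.2.2).card =
      ∑ j, ∑ c, (Finset.univ.filter (big j c)).card := by
    simp only [Finset.card_filter, Fintype.sum_prod_type]
  rw [hsum]
  calc ∑ j, ∑ c, (Finset.univ.filter (big j c)).card
      ≤ ∑ j : J, ∑ c : κ, (r + (if badJ j then Fintype.card ι else 0) +
          (if badκ c then Fintype.card ι else 0)) :=
        Finset.sum_le_sum fun j _ => Finset.sum_le_sum fun c _ => by
          have h1 : (Finset.univ.filter (big j c)).card ≤ Fintype.card ι := Finset.card_le_univ _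
          by_cases hj : badJ j <;> by_cases hc : badκ c <;> simp only [hj, hc, if_true, if_false]
          · omega
          · omega
          · omega
          · exact hbig j c hj hc
    _ = Fintype.card J * Fintype.card κ * r +
        (Finset.univ.filter badJ).card * Fintype.card κ * Fintype.card ι +
        Fintype.card J * (Finset.univ.filter badκ).card * Fintype.card ι := by
        simp only [Finset.sum_add_distrib, Finset.sum_const, Finset.card_univ, smul_eq_mul,
          ← Finset.sum_filter, Finset.sum_const]
        simp only [← Finset.mul_sum, ← Finset.sum_filter, Finset.sum_const, smul_eq_mul]
        ring

open Classical in
theorem chunkBad_or_columnBad_or_of_compatible {f : J → κ → ι → Γ} {g : κ → κ → Γ}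
    {y : J × κ × ι → Γ} {n : ℕ}
    (hy : ∀ q, y q ∈ compatibleColors Q T ρ (fun a => f q.1 a q.2.2) (g q.2.1))
    (hn : n + Fintype.card J * Fintype.card κ * r + r * Fintype.card κ * Fintype.card ι +
      Fintype.card J * s * Fintype.card ι ≤ Fintype.card J * Fintype.card κ * Fintype.card ι) :
    r ≤ (Finset.univ.filter fun j => ChunkBad β r s Q ρ small (f j)).card ∨
    s ≤ (Finset.univ.filter fun c => ColumnBad β r s Q T ρ small f (g c)).card ∨
    n ≤ (Finset.univ.filter fun q => ¬ IsBig β (compatibleColors Q T ρ (fun a => f q.1 a q.2.2)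
      (g q.2.1)) ∧ y q ∈ compatibleColors Q T ρ (fun a => f q.1 a q.2.2) (g q.2.1)).card := by
  by_contra! hcon
  obtain ⟨hJ, hκ, hn'⟩ := hcon
  set big := fun j c i => IsBig β (compatibleColors Q T ρ (fun a => f j a i) (g c))
  have h1 := card_filter_triple_le (r := r) (big := big)
    (badJ := fun j => ChunkBad β r s Q ρ small (f j))
    (badκ := fun c => ColumnBad β r s Q T ρ small f (g c)) (by
      intro j c hj hc
      by_contra! hlt
      refine hc ⟨(j, Finset.univ.filter (big j c), fun i =>
        compatibleColors Q T ρ (fun a => f j a i) (g c)), ⟨hj, hlt.le, fun b hb => ?_⟩, ?_⟩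
      · simpa using hb
      · intro a b _ y hy
        simp only [compatibleColors, Finset.mem_filter, Finset.mem_univ, true_and] at hy
        exact hy a)
  have h2 := Finset.card_filter_add_card_filter_not (s := Finset.univ)
    fun q : J × κ × ι => big q.1 q.2.1 q.2.2
  simp only [hy, and_true] at hn'
  rw [Finset.card_univ, Fintype.card_prod, Fintype.card_prod] at h2
  have h3 : (Finset.univ.filter fun j => ChunkBad β r s Q ρ small (f j)).card * Fintype.card κ *
      Fintype.card ι ≤ r * Fintype.card κ * Fintype.card ι := by gcongr
  have h4 : Fintype.card J * (Finset.univ.filter fun c => ColumnBad β r s Q T ρ small f (g c)).card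
      * Fintype.card ι ≤ Fintype.card J * s * Fintype.card ι := by gcongr
  have h5 : (Finset.univ.filter fun q : J × κ × ι => ¬ big q.1 q.2.1 q.2.2).card < n := hn'
  rw [← mul_assoc] at h2
  omega

variable [DecidableEq κ] [DecidableEq ι]

theorem density_small_forcedColors_le (h : IsMixing β Q T ρ small) (h0 : 0 ≤ β) (h1 : β ≤ 1)
    {q : Finset ι × (ι → Finset Γ)} (hq : IsRich β r q) :
    density (fun ψ : ι → Γ => small (forcedColors Q ρ ψ q.1 q.2)) ≤
      2 ^ Fintype.card Γ * β ^ r := by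
  classical
  calc _ ≤ density (fun ψ : ι → Γ => ∃ V, small V ∧
          ∀ b ∈ q.1, ∀ y ∈ q.2 b, Q (ψ b) y → ρ (ψ b) y ∈ V) :=
        density_mono fun ψ hψ => ⟨_, hψ, fun b hb y hy hQ => by
          simp only [forcedColors, Finset.mem_filter, Finset.mem_univ, true_and]
          exact ⟨b, hb, y, hy, hQ, rfl⟩⟩
    _ ≤ Fintype.card (Finset Γ) * β ^ r := by
        refine density_exists_le (by positivity) fun V hV => ?_
        refine (density_forall_mem_le (P := fun b x => ∀ y ∈ q.2 b, Q x y → ρ x y ∈ V)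
          fun b hb => h.confine V _ hV (hq.2 b hb)).trans ?_
        exact pow_le_pow_of_le_one h0 h1 hq.1
    _ = 2 ^ Fintype.card Γ * β ^ r := by simp

theorem density_chunkBad_le (h : IsMixing β Q T ρ small) (h0 : 0 ≤ β) (h1 : β ≤ 1) :
    density (ChunkBad (κ := κ) (ι := ι) β r s Q ρ small) ≤
      2 ^ Fintype.card ι * (2 ^ Fintype.card Γ) ^ Fintype.card ι *
        (2 ^ Fintype.card κ * (2 ^ Fintype.card Γ * β ^ r) ^ s) := by
  classical
  have := density_exists_le (Ω := κ → ι → Γ) (ι := Finset ι × (ι → Finset Γ))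
    (ε := 2 ^ Fintype.card κ * (2 ^ Fintype.card Γ * β ^ r) ^ s) (by positivity) fun q hq =>
    density_card_ge_le (ι := κ) (P := fun _ ψ => small (forcedColors Q ρ ψ q.1 q.2))
      (ε := 2 ^ Fintype.card Γ * β ^ r) (by positivity)
      (fun _ => density_small_forcedColors_le h h0 h1 hq) s
  rw [Fintype.card_prod, Fintype.card_fun, Fintype.card_finset, Fintype.card_finset] at this
  push_cast at this
  exact this

theorem density_columnBad_le (h : IsMixing β Q T ρ small) (h0 : 0 ≤ β) (h1 : β ≤ 1)
    (hs : 2 * s ≤ Fintype.card κ) (f : J → κ → ι → Γ) :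
    density (ColumnBad β r s Q T ρ small f) ≤
      Fintype.card J * (2 ^ Fintype.card ι * (2 ^ Fintype.card Γ) ^ Fintype.card ι) * β ^ s := by
  classical
  have := density_exists_le (Ω := κ → Γ) (ι := J × Finset ι × (ι → Finset Γ)) (ε := β ^ s)
    (C := fun q => ¬ ChunkBad β r s Q ρ small (f q.1) ∧ IsRich β r q.2)
    (P := fun q γ => ∀ a, ∀ b ∈ q.2.1, ∀ y ∈ q.2.2 b,
      ¬ (Q (f q.1 a b) y ∧ T (ρ (f q.1 a b) y) (γ a))) (by positivity) ?_
  · rw [Fintype.card_prod, Fintype.card_prod, Fintype.card_fun, Fintype.card_finset,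
      Fintype.card_finset] at this
    push_cast at this
    exact this
  rintro ⟨j, q⟩ ⟨hgood, hq⟩
  set V := fun a => forcedColors Q ρ (f j a) q.1 q.2
  have hcard : s ≤ (Finset.univ.filter fun a => ¬ small (V a)).card := by
    have h1 := Finset.card_filter_add_card_filter_not (s := Finset.univ) fun a => small (V a)
    have h2 : (Finset.univ.filter fun a => small (V a)).card < s := by
      by_contra! hle
      exact hgood ⟨q, hq, by convert hle⟩
    rw [Finset.card_univ] at h1
    omega
  refine (density_mono fun γ hγ => ?_).trans ((density_forall_mem_le
    (P := fun a z => ∀ v ∈ V a, ¬ T v z) (I := Finset.univ.filter fun a => ¬ small (V a))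
    fun a ha => h.avoid _ (Finset.mem_filter.1 ha).2).trans (pow_le_pow_of_le_one h0 h1 hcard))
  intro a _ v hv hT
  simp only [V, forcedColors, Finset.mem_filter, Finset.mem_univ, true_and] at hv
  obtain ⟨b, hb, y, hy, hQ, rfl⟩ := hv
  exact hγ a b hb y hy ⟨hQ, hT⟩

open Classical in
theorem density_compatibleColors_not_isBig_le [DecidableEq J] (h0 : 0 ≤ β) (f : J → κ → ι → Γ)
    (g : κ → κ → Γ) (n : ℕ) :
    density (fun y : J × κ × ι → Γ => n ≤ (Finset.univ.filter fun q =>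
      ¬ IsBig β (compatibleColors Q T ρ (fun a => f q.1 a q.2.2) (g q.2.1)) ∧
        y q ∈ compatibleColors Q T ρ (fun a => f q.1 a q.2.2) (g q.2.1)).card) ≤
      2 ^ Fintype.card (J × κ × ι) * β ^ n := by
  have := density_card_ge_le (P := fun (q : J × κ × ι) z =>
    ¬ IsBig β (compatibleColors Q T ρ (fun a => f q.1 a q.2.2) (g q.2.1)) ∧
      z ∈ compatibleColors Q T ρ (fun a => f q.1 a q.2.2) (g q.2.1)) h0 (fun q => ?_) n
  · convert this
  by_cases hb : IsBig β (compatibleColors Q T ρ (fun a => f q.1 a q.2.2) (g q.2.1))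
  · simpa [hb, density_false] using h0
  · simp only [hb, not_false_eq_true, true_and, density_eq]
    refine div_le_of_le_mul₀ (by positivity) h0 ?_
    simpa [IsBig] using hb

theorem density_forall_mem_compatibleColors_le [DecidableEq J]
    (h : IsMixing β Q T ρ small) (h0 : 0 ≤ β)
    (h1 : β ≤ 1) (hr : Fintype.card Γ + 1 ≤ r) (hJ : Fintype.card J = 8 * r)
    (hκ : Fintype.card κ = 64 * r ^ 2) (hι : Fintype.card ι = 8 * r) :
    density (fun ω : (J → κ → ι → Γ) ×
      (κ → κ → Γ) ×
      (J × κ × ι → Γ) =>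
        ∀ q, ω.2.2 q ∈ compatibleColors Q T ρ (fun a => ω.1 q.1 a q.2.2) (ω.2.1 q.2.1)) ≤
      3 * (2 ^ (4096 * r ^ 4) * β ^ (32 * r ^ 4)) := by
  classical
  have hr1 : 1 ≤ r := by omega
  set L := Fintype.card Γ
  set s := 32 * r ^ 2
  set ε : ℝ := 2 ^ (4096 * r ^ 4) * β ^ (32 * r ^ 4)
  have hε : 0 ≤ ε := by positivity
  have hbound : ∀ {a b : ℕ}, a ≤ 4096 * r ^ 4 → 32 * r ^ 4 ≤ b → 2 ^ a * β ^ b ≤ ε := by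
    intro a b ha hb
    exact mul_le_mul (pow_le_pow_right₀ (by norm_num) ha) (pow_le_pow_of_le_one h0 h1 hb)
      (by positivity) (by positivity)
  have hp12 : r ^ 1 ≤ r ^ 2 := Nat.pow_le_pow_right hr1 (by norm_num)
  have hp23 : r ^ 2 ≤ r ^ 3 := Nat.pow_le_pow_right hr1 (by norm_num)
  have hp34 : r ^ 3 ≤ r ^ 4 := Nat.pow_le_pow_right hr1 (by norm_num)
  have hrL : r * (L + 1) ≤ r ^ 2 := by nlinarith
  -- the chunks
  have hF : density (fun f : J → κ → ι → Γ =>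
      r ≤ (Finset.univ.filter fun j => ChunkBad β r s Q ρ small (f j)).card) ≤ ε := by
    have hchunk : density (ChunkBad (κ := κ) (ι := ι) β r s Q ρ small) ≤
        2 ^ (104 * r ^ 3) * β ^ (32 * r ^ 3) := by
      refine (density_chunkBad_le h h0 h1).trans ?_
      simp only [hκ, hι]
      calc (2 : ℝ) ^ (8 * r) * (2 ^ L) ^ (8 * r) * (2 ^ (64 * r ^ 2) * (2 ^ L * β ^ r) ^ s)
          = 2 ^ (8 * (r * (L + 1)) + 64 * r ^ 2 + L * s) * β ^ (32 * r ^ 3) := by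
            simp only [s]
            ring
        _ ≤ _ := by
            gcongr
            · norm_num
            · simp only [s]
              nlinarith
    refine (density_card_ge_le (P := fun _ : J => ChunkBad β r s Q ρ small)
      (by positivity) (fun _ => hchunk) r).trans ?_
    rw [hJ, mul_pow, ← mul_assoc, ← pow_mul, ← pow_mul, ← pow_add]
    exact hbound (by nlinarith) (by nlinarith)
  -- the columns
  have hG : ∀ f : J → κ → ι → Γ,
      density (fun g : κ → κ → Γ =>
        s ≤ (Finset.univ.filter fun c => ColumnBad β r s Q T ρ small f (g c)).card) ≤ ε := by
    intro f
    have hcol : density (ColumnBad β r s Q T ρ small f) ≤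
        2 ^ (16 * r ^ 2) * β ^ (32 * r ^ 2) := by
      refine (density_columnBad_le h h0 h1 (by simp only [s, hκ]; omega) f).trans ?_
      simp only [hJ, hι]
      have : ((8 * r : ℕ) : ℝ) ≤ 2 ^ (8 * r) := by exact_mod_cast Nat.lt_two_pow_self.le
      calc ((8 * r : ℕ) : ℝ) * (2 ^ (8 * r) * (2 ^ L) ^ (8 * r)) * β ^ s
          ≤ 2 ^ (8 * r) * (2 ^ (8 * r) * (2 ^ L) ^ (8 * r)) * β ^ s := by gcongr
        _ = 2 ^ (8 * r + 8 * (r * (L + 1))) * β ^ s := by ring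
        _ ≤ _ := by
            gcongr
            · norm_num
            · nlinarith
    refine (density_card_ge_le (P := fun _ : κ => ColumnBad β r s Q T ρ small f)
      (by positivity) (fun _ => hcol) s).trans ?_
    rw [hκ, mul_pow, ← mul_assoc, ← pow_mul, ← pow_mul, ← pow_add]
    exact hbound (by simp only [s]; nlinarith) (by simp only [s]; nlinarith)
  -- the remaining colors
  have hY : ∀ (f : J → κ → ι → Γ)
      (g : κ → κ → Γ),
      density (fun y : J × κ × ι → Γ =>
        1024 * r ^ 4 ≤ (Finset.univ.filter fun q =>
          ¬ IsBig β (compatibleColors Q T ρ (fun a => f q.1 a q.2.2) (g q.2.1)) ∧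
            y q ∈ compatibleColors Q T ρ (fun a => f q.1 a q.2.2) (g q.2.1)).card) ≤ ε := by
    intro f g
    refine (density_compatibleColors_not_isBig_le h0 f g (1024 * r ^ 4)).trans ?_
    simp only [Fintype.card_prod, hJ, hκ, hι]
    exact hbound (le_of_eq (by ring)) (by omega)
  calc _ ≤ density (fun ω : (J → κ → ι → Γ) ×
      (κ → κ → Γ) ×
      (J × κ × ι → Γ) =>
        r ≤ (Finset.univ.filter fun j => ChunkBad β r s Q ρ small (ω.1 j)).card ∨
        s ≤ (Finset.univ.filter fun c => ColumnBad β r s Q T ρ small ω.1 (ω.2.1 c)).card ∨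
        1024 * r ^ 4 ≤ (Finset.univ.filter fun q =>
          ¬ IsBig β (compatibleColors Q T ρ (fun a => ω.1 q.1 a q.2.2) (ω.2.1 q.2.1)) ∧
            ω.2.2 q ∈ compatibleColors Q T ρ (fun a => ω.1 q.1 a q.2.2) (ω.2.1 q.2.1)).card) :=
        density_mono fun ω hω => by
          convert chunkBad_or_columnBad_or_of_compatible (β := β) (r := r) (s := s)
            (small := small) (n := 1024 * r ^ 4) hω ?_
          simp only [hJ, hκ, hι, s]
          exact le_of_eq (by ring)
    _ ≤ ε + (ε + ε) := by
        refine (density_or_le _ _).trans (add_le_add ?_ ((density_or_le _ _).trans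
          (add_le_add ?_ ?_)))
        · exact density_prod_le' hε fun _ => hF
        · exact density_prod_le hε fun f => density_prod_le' hε fun _ => hG f
        · exact density_prod_le hε fun f => density_prod_le hε fun g => hY f g
    _ = 3 * ε := by ring

end Counting

section RandomColoring

theorem exists_not_of_density_lt_one {Ω : Type*} [Fintype Ω] [Nonempty Ω] {P : Ω → Prop}
    (h : density P < 1) : ∃ ω, ¬ P ω := by
  classical
  by_contra! hP
  refine h.ne ?_
  simp [density_eq, hP]

/-- Maps on a disjoint union of products, in curried form. -/
def sumPiEquiv (J κ ι Γ : Type*) : ((J × κ × ι) ⊕ (κ × κ) ⊕ (J × κ × ι) → Γ) ≃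
    (J → κ → ι → Γ) × (κ → κ → Γ) × (J × κ × ι → Γ) where
  toFun h := (fun j a i => h (Sum.inl (j, a, i)), fun c a => h (Sum.inr (Sum.inl (c, a))),
    fun q => h (Sum.inr (Sum.inr q)))
  invFun ω := Sum.elim (fun q => ω.1 q.1 q.2.1 q.2.2)
    (Sum.elim (fun q => ω.2.1 q.1 q.2) ω.2.2)
  left_inv h := by
    ext q
    rcases q with q | q | q <;> rfl
  right_inv ω := rfl

variable {Γ J κ ι : Type*} [Fintype Γ] [Fintype J] [Fintype κ] [Fintype ι] [DecidableEq J]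
  [DecidableEq κ] [DecidableEq ι] {β : ℝ} {r N : ℕ} {Q T : Γ → Γ → Prop} {ρ : Γ → Γ → Γ}
  {small : Finset Γ → Prop}

theorem density_independent_le (h : IsMixing β Q T ρ small) (h0 : 0 ≤ β) (h1 : β ≤ 1)
    (hr : Fintype.card Γ + 1 ≤ r) (hJ : Fintype.card J = 8 * r)
    (hκ : Fintype.card κ = 64 * r ^ 2) (hι : Fintype.card ι = 8 * r)
    {v₁ v₃ : κ → Fin N} {v₂ : J × ι → Fin N} (hv₁ : v₁.Injective) (hv₂ : v₂.Injective)
    (hv₃ : v₃.Injective) (h12 : ∀ a b, v₁ a < v₂ b) (h23 : ∀ b c, v₂ b < v₃ c) :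
    density (fun χ : Fin N × Fin N → Γ => ∀ a b c, ¬ (Q (χ (v₁ a, v₂ b)) (χ (v₂ b, v₃ c)) ∧
      T (ρ (χ (v₁ a, v₂ b)) (χ (v₂ b, v₃ c))) (χ (v₁ a, v₃ c)))) ≤
      3 * (2 ^ (4096 * r ^ 4) * β ^ (32 * r ^ 4)) := by
  let f : (J × κ × ι) ⊕ (κ × κ) ⊕ (J × κ × ι) → Fin N × Fin N :=
    Sum.elim (fun q => (v₁ q.2.1, v₂ (q.1, q.2.2)))
      (Sum.elim (fun q => (v₁ q.2, v₃ q.1)) fun q => (v₂ (q.1, q.2.2), v₃ q.2.1))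
  have hf : f.Injective := by
    refine Function.Injective.sumElim ?_ (Function.Injective.sumElim ?_ ?_ ?_) ?_
    · rintro ⟨j, a, i⟩ ⟨j', a', i'⟩ hq
      obtain ⟨h1, h2⟩ := Prod.ext_iff.1 hq
      have h1 := hv₁ h1
      have h2 := Prod.ext_iff.1 (hv₂ h2)
      simp_all
    · rintro ⟨c, a⟩ ⟨c', a'⟩ hq
      obtain ⟨h1, h2⟩ := Prod.ext_iff.1 hq
      exact Prod.ext (hv₃ h2) (hv₁ h1)
    · rintro ⟨j, a, i⟩ ⟨j', a', i'⟩ hq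
      obtain ⟨h1, h2⟩ := Prod.ext_iff.1 hq
      have h1 := hv₃ h2
      have h2 := Prod.ext_iff.1 (hv₂ (Prod.ext_iff.1 hq).1)
      simp_all
    · intro q q' hq
      exact (h12 _ _).ne (Prod.ext_iff.1 hq).1
    · rintro q (q' | q') hq
      · exact (h23 _ _).ne (Prod.ext_iff.1 hq).2
      · exact (h12 _ _).ne (Prod.ext_iff.1 hq).1
  let E : (J → κ → ι → Γ) × (κ → κ → Γ) × (J × κ × ι → Γ) → Prop := fun ω =>
    ∀ q, ω.2.2 q ∈ compatibleColors Q T ρ (fun a => ω.1 q.1 a q.2.2) (ω.2.1 q.2.1)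
  calc _ ≤ density (fun χ : Fin N × Fin N → Γ => E (sumPiEquiv J κ ι Γ (χ ∘ f))) :=
        density_mono fun χ hχ q => by
          simp only [compatibleColors, Finset.mem_filter, Finset.mem_univ, true_and]
          exact fun a => hχ a (q.1, q.2.2) q.2.1
    _ ≤ density (fun h => E (sumPiEquiv J κ ι Γ h)) :=
        density_comp_injective_le hf fun h => E (sumPiEquiv J κ ι Γ h)
    _ = density E := density_comp_equiv _ _
    _ ≤ _ := density_forall_mem_compatibleColors_le h h0 h1 hr hJ hκ hι

theorem exists_coloring [Nonempty Γ] (h : IsMixing β Q T ρ small) (h0 : 0 ≤ β) (h1 : β ≤ 1)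
    (hr : Fintype.card Γ + 1 ≤ r) (hJ : Fintype.card J = 8 * r)
    (hκ : Fintype.card κ = 64 * r ^ 2) (hι : Fintype.card ι = 8 * r)
    (hN : (N : ℝ) ^ (192 * r ^ 2) * (3 * (2 ^ (4096 * r ^ 4) * β ^ (32 * r ^ 4))) < 1) :
    ∃ χ : Fin N × Fin N → Γ, ∀ (v₁ : κ → Fin N) (v₂ : J × ι → Fin N) (v₃ : κ → Fin N),
      v₁.Injective → v₂.Injective → v₃.Injective → (∀ a b, v₁ a < v₂ b) →
      (∀ b c, v₂ b < v₃ c) → ∃ a b c, Q (χ (v₁ a, v₂ b)) (χ (v₂ b, v₃ c)) ∧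
        T (ρ (χ (v₁ a, v₂ b)) (χ (v₂ b, v₃ c))) (χ (v₁ a, v₃ c)) := by
  have hd := density_exists_le (Ω := Fin N × Fin N → Γ)
    (ι := (κ → Fin N) × (J × ι → Fin N) × (κ → Fin N))
    (C := fun v => v.1.Injective ∧ v.2.1.Injective ∧ v.2.2.Injective ∧
      (∀ a b, v.1 a < v.2.1 b) ∧ ∀ b c, v.2.1 b < v.2.2 c)
    (P := fun v χ => ∀ a b c, ¬ (Q (χ (v.1 a, v.2.1 b)) (χ (v.2.1 b, v.2.2 c)) ∧
      T (ρ (χ (v.1 a, v.2.1 b)) (χ (v.2.1 b, v.2.2 c))) (χ (v.1 a, v.2.2 c))))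
    (ε := 3 * (2 ^ (4096 * r ^ 4) * β ^ (32 * r ^ 4))) (by positivity)
    fun v ⟨hv₁, hv₂, hv₃, h12, h23⟩ =>
      density_independent_le h h0 h1 hr hJ hκ hι hv₁ hv₂ hv₃ h12 h23
  have hcard : (Fintype.card ((κ → Fin N) × (J × ι → Fin N) × (κ → Fin N)) : ℝ) =
      N ^ (192 * r ^ 2) := by
    simp only [Fintype.card_prod, Fintype.card_fun, Fintype.card_fin, hJ, hκ, hι]
    push_cast
    rw [← pow_add, ← pow_add]
    congr 1
    ring
  rw [hcard] at hd
  obtain ⟨χ, hχ⟩ := exists_not_of_density_lt_one (hd.trans_lt hN)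
  refine ⟨χ, fun v₁ v₂ v₃ hv₁ hv₂ hv₃ h12 h23 => ?_⟩
  by_contra! hno
  exact hχ ⟨(v₁, v₂, v₃), ⟨hv₁, hv₂, hv₃, h12, h23⟩, fun a b c habc => hno a b c habc.1 habc.2⟩

end RandomColoring

section PairColoring

variable {Λ : Type*}

/-- The red triples of a coloring of pairs by `Λ × Λ` induced by a relation on `Λ`. -/
def IsRed (H : Λ → Λ → Prop) (χ : ℕ → ℕ → Λ × Λ) (a b c : ℕ) : Prop :=
  H (χ a b).2 (χ b c).1 ∧ H (χ a b).1 (χ a c).1 ∧ H (χ a c).2 (χ b c).2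

theorem topSparse_isRed {H : Λ → Λ → Prop} (hH : ∀ u v w, H u v → H v w → ¬ H u w)
    (χ : ℕ → ℕ → Λ × Λ) : TopSparse (IsRed H χ) := by
  intro a b c d _ _ _ hbcd
  refine ⟨fun h => ?_, fun h => ?_, fun h => ?_⟩
  · exact hH _ _ _ h.1.1 hbcd.2.1 h.2.1
  · exact hH _ _ _ h.1.2.2 hbcd.1 h.2.1
  · exact hH _ _ _ h.1.2.2 hbcd.2.2 h.2.2.2

theorem isMixing_of_isExpanding [Fintype Λ] [Nonempty Λ] {H : Λ → Λ → Prop} {w : ℕ}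
    (hH : IsExpanding H w) (hw : 0 < w) :
    IsMixing (8 / w : ℝ) (fun x y : Λ × Λ => H x.2 y.1) (fun v z => H v.1 z.1 ∧ H z.2 v.2)
      (fun x y => (x.1, y.2)) (fun V => w ^ 2 * V.card < 2 * Fintype.card Λ ^ 2) := by
  have hw' : (0 : ℝ) < w := by exact_mod_cast hw
  have hdens : ∀ (P : Λ × Λ → Prop) (_ : DecidablePred P),
      w * (Finset.univ.filter P).card ≤ 8 * Fintype.card Λ ^ 2 →
      density P ≤ 8 / w := by
    intro P _ hP
    have hP' : (w : ℝ) * (Finset.univ.filter P).card ≤ 8 * Fintype.card Λ ^ 2 := by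
      exact_mod_cast hP
    rw [density_eq]
    refine div_le_of_le_mul₀ (by positivity) (by positivity) ?_
    rw [div_mul_eq_mul_div, le_div_iff₀ hw', Fintype.card_prod]
    push_cast
    linarith
  constructor
  · intro V hV
    have hlt := card_filter_forall_not_lt hH Fintype.card_pos (not_lt.1 hV)
    have hle := hlt.le.trans (Nat.mul_le_mul_right (Fintype.card Λ ^ 2) (show 2 ≤ 8 by norm_num))
    exact hdens _ _ (le_trans (Nat.mul_le_mul_right _ (Nat.le_self_pow two_ne_zero w)) hle)
  · intro V Y hV hY
    have hY' : 8 * Fintype.card Λ ^ 2 < w * Y.card := by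
      rw [IsBig, div_mul_eq_mul_div, div_lt_iff₀ hw', Fintype.card_prod] at hY
      push_cast at hY
      have : (8 * Fintype.card Λ ^ 2 : ℝ) < w * Y.card := by linarith
      exact_mod_cast this
    have hle := (card_filter_forall_mem_le hH hV hY').trans
      (Nat.mul_le_mul_right (Fintype.card Λ ^ 2) (show 3 ≤ 8 by norm_num))
    exact hdens _ _ hle

end PairColoring

theorem unionBound_lt_one {w r N : ℕ} (hw : 2 ^ 250 ≤ w) (hr : 1 ≤ r)
    (hN : N = w ^ (r ^ 2 / 16)) :
    (N : ℝ) ^ (192 * r ^ 2) *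
      (3 * (2 ^ (4096 * r ^ 4) * (8 / w : ℝ) ^ (32 * r ^ 4))) < 1 := by
  have hw1 : 1 ≤ w := le_trans Nat.one_le_two_pow hw
  have hw0 : (0 : ℝ) < w := by exact_mod_cast hw1
  have hX : 1 ≤ r ^ 4 := Nat.one_le_pow _ _ hr
  generalize hXr : r ^ 4 = X at hX
  have hNle : N ^ (192 * r ^ 2) ≤ w ^ (12 * X) := by
    rw [hN, ← pow_mul]
    refine Nat.pow_le_pow_right hw1 ?_
    calc r ^ 2 / 16 * (192 * r ^ 2) = (r ^ 2 / 16 * 16) * (12 * r ^ 2) := by ring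
      _ ≤ r ^ 2 * (12 * r ^ 2) := Nat.mul_le_mul_right _ (Nat.div_mul_le_self _ _)
      _ = 12 * X := by rw [← hXr]; ring
  have htwo : 2 ^ (4194 * X) ≤ w ^ (20 * X) :=
    calc 2 ^ (4194 * X) ≤ 2 ^ (250 * (20 * X)) := Nat.pow_le_pow_right two_pos (by omega)
      _ = (2 ^ 250) ^ (20 * X) := pow_mul _ _ _
      _ ≤ w ^ (20 * X) := Nat.pow_le_pow_left hw _
  have hthree : 3 < 2 ^ (2 * X) :=
    lt_of_lt_of_le (by norm_num) (Nat.pow_le_pow_right two_pos (show 2 ≤ 2 * X by omega))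
  have hnat : N ^ (192 * r ^ 2) * (3 * (2 ^ (4096 * X) * 8 ^ (32 * X))) < w ^ (32 * X) :=
    calc N ^ (192 * r ^ 2) * (3 * (2 ^ (4096 * X) * 8 ^ (32 * X)))
        ≤ w ^ (12 * X) * (3 * (2 ^ (4096 * X) * 8 ^ (32 * X))) := Nat.mul_le_mul_right _ hNle
      _ < w ^ (12 * X) * (2 ^ (2 * X) * (2 ^ (4096 * X) * 8 ^ (32 * X))) := by gcongr
      _ = w ^ (12 * X) * 2 ^ (4194 * X) := by
          rw [show (8 : ℕ) = 2 ^ 3 by norm_num, ← pow_mul, ← pow_add, ← pow_add]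
          congr 2
          ring
      _ ≤ w ^ (12 * X) * w ^ (20 * X) := Nat.mul_le_mul_left _ htwo
      _ = w ^ (32 * X) := by rw [← pow_add]; congr 1; ring
  have hreal : (N : ℝ) ^ (192 * r ^ 2) * (3 * (2 ^ (4096 * X) * 8 ^ (32 * X))) <
      (w : ℝ) ^ (32 * X) := by exact_mod_cast hnat
  rw [div_pow, ← mul_div_assoc, ← mul_div_assoc, ← mul_div_assoc, div_lt_one (by positivity)]
  exact hreal

theorem exists_isRed_of_coloring {Λ : Type*} [Nonempty Λ] {H : Λ → Λ → Prop} {r N : ℕ}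
    {χ : Fin N × Fin N → Λ × Λ}
    (hχ : ∀ (v₁ : Fin (64 * r ^ 2) → Fin N) (v₂ : Fin (8 * r) × Fin (8 * r) → Fin N)
      (v₃ : Fin (64 * r ^ 2) → Fin N), v₁.Injective → v₂.Injective → v₃.Injective →
      (∀ a b, v₁ a < v₂ b) → (∀ b c, v₂ b < v₃ c) →
      ∃ a b c, H (χ (v₁ a, v₂ b)).2 (χ (v₂ b, v₃ c)).1 ∧
        H (χ (v₁ a, v₂ b)).1 (χ (v₁ a, v₃ c)).1 ∧ H (χ (v₁ a, v₃ c)).2 (χ (v₂ b, v₃ c)).2) :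
    ∃ χ' : ℕ → ℕ → Λ × Λ, ∀ A ⊆ Finset.range N, A.card = 192 * r ^ 2 →
      ∃ a ∈ A, ∃ b ∈ A, ∃ c ∈ A, a < b ∧ b < c ∧ IsRed H χ' a b c := by
  classical
  refine ⟨fun a b => if h : a < N ∧ b < N then χ (⟨a, h.1⟩, ⟨b, h.2⟩) else
    Classical.arbitrary _, fun A hA hcard => ?_⟩
  let vert : Fin (192 * r ^ 2) → Fin N := fun t =>
    ⟨A.orderEmbOfFin hcard t, Finset.mem_range.1 (hA (A.orderEmbOfFin_mem hcard t))⟩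
  have hmem : ∀ t, (vert t : ℕ) ∈ A := fun t => A.orderEmbOfFin_mem hcard t
  have hmono : StrictMono vert := fun s t hst => (A.orderEmbOfFin hcard).strictMono hst
  let e : Fin (8 * r) × Fin (8 * r) ≃ Fin (64 * r ^ 2) :=
    Fintype.equivFinOfCardEq (by simp only [Fintype.card_prod, Fintype.card_fin]; ring)
  let i₁ : Fin (64 * r ^ 2) → Fin (192 * r ^ 2) := fun a => ⟨a, by omega⟩
  let i₂ : Fin (64 * r ^ 2) → Fin (192 * r ^ 2) := fun a => ⟨64 * r ^ 2 + a, by omega⟩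
  let i₃ : Fin (64 * r ^ 2) → Fin (192 * r ^ 2) := fun a => ⟨128 * r ^ 2 + a, by omega⟩
  have h12 : ∀ a b, i₁ a < i₂ b := fun a b => by simp only [i₁, i₂, Fin.mk_lt_mk]; omega
  have h23 : ∀ a b, i₂ a < i₃ b := fun a b => by simp only [i₂, i₃, Fin.mk_lt_mk]; omega
  obtain ⟨a, b, c, h⟩ := hχ (vert ∘ i₁) (vert ∘ i₂ ∘ e) (vert ∘ i₃)
    (hmono.injective.comp fun a b h => by simpa [i₁, Fin.ext_iff] using h)
    (hmono.injective.comp (Function.Injective.comp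
      (fun a b h => by simpa [i₂, Fin.ext_iff] using h) e.injective))
    (hmono.injective.comp fun a b h => by simpa [i₃, Fin.ext_iff] using h)
    (fun a b => hmono (h12 _ _)) (fun b c => hmono (h23 _ _))
  refine ⟨_, hmem (i₁ a), _, hmem (i₂ (e b)), _, hmem (i₃ c), hmono (h12 _ _), hmono (h23 _ _), ?_⟩
  simpa [IsRed] using h

theorem exists_topSparse {w : ℕ} (hw : 2 ^ 250 ≤ w) :
    ∃ φ, TopSparse φ ∧ ∀ A ⊆ Finset.range (w ^ (w ^ 40 / 16)), A.card = 192 * w ^ 40 →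
      ∃ a ∈ A, ∃ b ∈ A, ∃ c ∈ A, a < b ∧ b < c ∧ φ a b c := by
  have hw16 : 2 ^ 16 ≤ w := le_trans (Nat.pow_le_pow_right two_pos (by norm_num)) hw
  have hw0 : 0 < w := by omega
  obtain ⟨p, hp, hlt, hle⟩ := Nat.exists_prime_lt_and_le_two_mul (4 * w ^ 4) (by positivity)
  have : Fact p.Prime := ⟨hp⟩
  have hp2 : p ≠ 2 := by
    have := Nat.one_le_pow 4 w hw0
    omega
  have hcard : Fintype.card ((ZMod p × ZMod p) × (ZMod p × ZMod p)) + 1 ≤ w ^ 20 := by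
    simp only [Fintype.card_prod, ZMod.card]
    have h1 : p * p * (p * p) ≤ 4096 * w ^ 16 :=
      calc p * p * (p * p) = p ^ 4 := by ring
        _ ≤ (2 * (4 * w ^ 4)) ^ 4 := Nat.pow_le_pow_left hle 4
        _ = 4096 * w ^ 16 := by ring
    have h2 : 1 ≤ w ^ 16 := Nat.one_le_pow _ _ hw0
    have h3 : 4097 ≤ w ^ 4 := le_trans (by omega) (Nat.le_self_pow four_ne_zero w)
    calc p * p * (p * p) + 1 ≤ 4097 * w ^ 16 := by omega
      _ ≤ w ^ 4 * w ^ 16 := Nat.mul_le_mul_right _ h3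
      _ = w ^ 20 := by ring
  have h40 : w ^ 40 = (w ^ 20) ^ 2 := by ring
  have h8w : (8 / w : ℝ) ≤ 1 := by
    have : (8 : ℝ) ≤ w := by exact_mod_cast (show 8 ≤ w by omega)
    exact div_le_one_of_le₀ this (by positivity)
  obtain ⟨χ, hχ⟩ := exists_coloring (J := Fin (8 * w ^ 20)) (κ := Fin (64 * (w ^ 20) ^ 2))
    (ι := Fin (8 * w ^ 20)) (N := w ^ (w ^ 40 / 16))
    (isMixing_of_isExpanding (isExpanding_parabolaAdj hp2 hlt) hw0) (by positivity) h8w hcard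
    (by simp) (by simp) (by simp)
    (unionBound_lt_one hw (Nat.one_le_pow _ _ hw0) (by rw [h40]))
  obtain ⟨χ', hχ'⟩ := exists_isRed_of_coloring hχ
  refine ⟨IsRed (ParabolaAdj (p := p)) χ',
    topSparse_isRed (H := ParabolaAdj (p := p))
      (fun _ _ _ huv hvw => not_parabolaAdj_of_transitive hp2 huv hvw) χ',
    fun A hA hA' => ?_⟩
  exact hχ' A hA (by rw [hA', h40])

theorem exists_pow_le_lt_pow {W L : ℕ} (hL : 384 * W ^ 40 ≤ L) :
    ∃ w, W ≤ w ∧ 384 * w ^ 40 ≤ L ∧ L < 384 * (w + 1) ^ 40 := by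
  let P : ℕ → Prop := fun w => 384 * w ^ 40 ≤ L
  have hbound : ∀ w, P w → w ≤ L := fun w h =>
    (Nat.le_self_pow (by norm_num) w).trans ((Nat.le_mul_of_pos_left _ (by norm_num)).trans h)
  refine ⟨Nat.findGreatest P L, Nat.le_findGreatest (hbound W hL) hL,
    Nat.findGreatest_spec (P := P) (hbound W hL) hL, ?_⟩
  by_contra! h
  have := Nat.le_findGreatest (P := P) (hbound _ h) h
  omega

theorem rpow_logb_logb_le {w n : ℕ} (hw : 2 ^ 250 ≤ w) (hn : 2 ^ (384 * w ^ 40) ≤ n)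
    (hn' : n < 2 ^ (384 * (w + 1) ^ 40)) :
    (n : ℝ) ^ ((2 ^ 60 : ℝ)⁻¹ * Real.logb 2 (Real.logb 2 (n : ℝ))) ≤
      (w : ℝ) ^ ((w : ℝ) ^ 40 / 32) := by
  have hwR : (2 : ℝ) ^ 250 ≤ w := by exact_mod_cast hw
  have hw1 : (1 : ℝ) ≤ w := le_trans (one_le_pow₀ one_le_two) hwR
  have hw0 : (0 : ℝ) < w := by linarith
  have hn0 : (0 : ℝ) < n := by exact_mod_cast lt_of_lt_of_le (Nat.two_pow_pos _) hn
  have hlogw : 250 ≤ Real.logb 2 w := by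
    rw [Real.le_logb_iff_rpow_le one_lt_two hw0]
    exact_mod_cast hwR
  have hlog_le : Real.logb 2 n ≤ 2 ^ 49 * (w : ℝ) ^ 40 := by
    have h1 : Real.logb 2 n ≤ 384 * ((w : ℝ) + 1) ^ 40 := by
      rw [Real.logb_le_iff_le_rpow one_lt_two hn0]
      have : (n : ℝ) ≤ (2 : ℝ) ^ (384 * (w + 1) ^ 40) := by exact_mod_cast hn'.le
      refine this.trans_eq ?_
      rw [← Real.rpow_natCast]
      push_cast
      rfl
    calc Real.logb 2 n ≤ 384 * ((w : ℝ) + 1) ^ 40 := h1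
      _ ≤ 384 * (2 * (w : ℝ)) ^ 40 := by gcongr; linarith
      _ = 384 * 2 ^ 40 * (w : ℝ) ^ 40 := by rw [mul_pow, mul_assoc]
      _ ≤ 2 ^ 49 * (w : ℝ) ^ 40 := by gcongr; norm_num
  have hlog_ge : 1 ≤ Real.logb 2 n := by
    rw [Real.le_logb_iff_rpow_le one_lt_two hn0, Real.rpow_one]
    have h1 : 1 ≤ w := by exact_mod_cast hw1
    have h2 : 2 ^ 1 ≤ n := le_trans (Nat.pow_le_pow_right two_pos
      (Nat.mul_pos (by norm_num) (Nat.pow_pos h1))) hn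
    exact_mod_cast h2
  have hloglog : Real.logb 2 (Real.logb 2 n) ≤ 41 * Real.logb 2 w :=
    calc Real.logb 2 (Real.logb 2 n) ≤ Real.logb 2 (2 ^ 49 * (w : ℝ) ^ 40) :=
          Real.logb_le_logb_of_le one_lt_two (by linarith) hlog_le
      _ = 49 + 40 * Real.logb 2 w := by
          rw [Real.logb_mul (by positivity) (by positivity), Real.logb_pow, Real.logb_pow,
            Real.logb_self_eq_one one_lt_two]
          norm_num
      _ ≤ 41 * Real.logb 2 w := by linarith
  have hloglog0 : 0 ≤ Real.logb 2 (Real.logb 2 n) := Real.logb_nonneg one_lt_two hlog_ge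
  rw [← Real.logb_le_logb one_lt_two (Real.rpow_pos_of_pos hn0 _)
    (Real.rpow_pos_of_pos hw0 _), Real.logb_rpow_eq_mul_logb_of_pos hn0,
    Real.logb_rpow_eq_mul_logb_of_pos hw0]
  calc (2 ^ 60 : ℝ)⁻¹ * Real.logb 2 (Real.logb 2 n) * Real.logb 2 n
      ≤ (2 ^ 60 : ℝ)⁻¹ * (41 * Real.logb 2 w) * (2 ^ 49 * (w : ℝ) ^ 40) := by gcongr
    _ = 41 * 2 ^ 49 * (2 ^ 60 : ℝ)⁻¹ * ((w : ℝ) ^ 40 * Real.logb 2 w) := by ring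
    _ ≤ 1 / 32 * ((w : ℝ) ^ 40 * Real.logb 2 w) := by gcongr; norm_num
    _ = (w : ℝ) ^ 40 / 32 * Real.logb 2 w := by ring

theorem rpow_pow_div_le {w : ℕ} (hw : 2 ≤ w) :
    (w : ℝ) ^ ((w : ℝ) ^ 40 / 32) ≤ ((w ^ (w ^ 40 / 16) - 1 : ℕ) : ℝ) := by
  have h40 : 64 ≤ w ^ 40 := le_trans (by norm_num) (Nat.pow_le_pow_left hw 40)
  have hw1 : (1 : ℝ) ≤ w := by exact_mod_cast (by omega : 1 ≤ w)
  have hexp : (w : ℝ) ^ 40 / 32 ≤ ((w ^ 40 / 16 - 1 : ℕ) : ℝ) := by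
    have h : w ^ 40 ≤ 32 * (w ^ 40 / 16 - 1) := by
      generalize w ^ 40 = X at h40
      omega
    rw [div_le_iff₀' (by norm_num)]
    exact_mod_cast h
  refine (Real.rpow_le_rpow_of_exponent_le hw1 hexp).trans ?_
  rw [Real.rpow_natCast]
  have h : w ^ (w ^ 40 / 16 - 1) ≤ w ^ (w ^ 40 / 16) - 1 :=
    Nat.le_sub_one_of_lt (Nat.pow_lt_pow_right (by omega) (by
      generalize w ^ 40 = X at h40
      omega))
  exact_mod_cast h

/-- There exists a constant `c > 0` such that for all sufficiently large `n`,
`r_4(5,4;n) ≥ 2^(n^(c · log log n))` (logarithms base 2). -/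
theorem stmt0 : ∃ c : ℝ, 0 < c ∧ ∃ n0 : ℕ, ∀ n : ℕ, n0 ≤ n →
    (2 : ℝ) ^ ((n : ℝ) ^ (c * Real.logb 2 (Real.logb 2 (n : ℝ)))) ≤ (ehRamsey 4 4 n : ℝ) := by
  obtain ⟨W, hW⟩ : ∃ W : ℕ, W = 2 ^ 250 := ⟨_, rfl⟩
  refine ⟨(2 ^ 60 : ℝ)⁻¹, by positivity, 2 ^ (384 * W ^ 40), fun n hn => ?_⟩
  have hn0 : n ≠ 0 := (lt_of_lt_of_le (Nat.two_pow_pos _) hn).ne'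
  obtain ⟨w, hWw, hle, hlt⟩ := exists_pow_le_lt_pow (Nat.le_log_of_pow_le one_lt_two hn)
  have hw : 2 ^ 250 ≤ w := hW ▸ hWw
  have hw2 : 2 ≤ w := le_trans (Nat.le_self_pow (by norm_num) 2) hw
  have hle' : 2 ^ (384 * w ^ 40) ≤ n := Nat.pow_le_of_le_log hn0 hle
  have hlt' : n < 2 ^ (384 * (w + 1) ^ 40) := Nat.lt_pow_of_log_lt one_lt_two hlt
  obtain ⟨φ, hφ, hind⟩ := exists_topSparse hw
  have hN : w ^ (w ^ 40 / 16) - 1 + 1 = w ^ (w ^ 40 / 16) :=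
    Nat.sub_add_cancel (Nat.one_le_pow _ _ (by omega))
  have hlower := two_pow_lt_ehRamsey hφ (N := w ^ (w ^ 40 / 16) - 1) (m := 192 * w ^ 40) (n := n)
    (by rwa [hN]) (by rwa [← mul_assoc])
  calc (2 : ℝ) ^ ((n : ℝ) ^ ((2 ^ 60 : ℝ)⁻¹ * Real.logb 2 (Real.logb 2 (n : ℝ))))
      ≤ (2 : ℝ) ^ ((w ^ (w ^ 40 / 16) - 1 : ℕ) : ℝ) :=
        Real.rpow_le_rpow_of_exponent_le one_le_two
          ((rpow_logb_logb_le hw hle' hlt').trans (rpow_pow_div_le hw2))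
    _ = ((2 ^ (w ^ (w ^ 40 / 16) - 1) : ℕ) : ℝ) := by rw [Real.rpow_natCast]; push_cast; rfl
    _ ≤ (ehRamsey 4 4 n : ℝ) := by exact_mod_cast hlower.le
end

section
/- For all sufficiently large n, r_4(5,4; 2^{2n}) > 2^{r_3(4,3;n) − 1}. -/
/-- Ramsey's theorem for two-colorings of `k`-sets. -/
theorem hypergraph_ramsey (k : ℕ) : ∀ s t : ℕ, ∃ N : ℕ, ∀ A : Finset ℕ, N ≤ A.card →
    ∀ χ : Finset ℕ → Bool,
      (∃ S ⊆ A, S.card = s ∧ ∀ e ∈ S.powersetCard k, χ e = true) ∨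
      (∃ T ⊆ A, T.card = t ∧ ∀ e ∈ T.powersetCard k, χ e = false) := by
  induction k with
  | zero =>
    intro s t
    refine ⟨max s t, fun A hA χ => ?_⟩
    obtain ⟨S, hS, hSc⟩ := Finset.exists_subset_card_eq (le_trans (le_max_left s t) hA)
    obtain ⟨T, hT, hTc⟩ := Finset.exists_subset_card_eq (le_trans (le_max_right s t) hA)
    cases h : χ ∅ with
    | true => exact Or.inl ⟨S, hS, hSc, by simp [h]⟩
    | false => exact Or.inr ⟨T, hT, hTc, by simp [h]⟩
  | succ k ihk =>
    have extend (χ : Finset ℕ → Bool) (c : Bool) (a : ℕ) (U V : Finset ℕ) (hUV : U ⊆ V)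
        (hV : ∀ e ∈ V.powersetCard k, χ (insert a e) = c)
        (hU : ∀ e ∈ U.powersetCard (k + 1), χ e = c) :
        ∀ e ∈ (insert a U).powersetCard (k + 1), χ e = c := by
      intro e he
      rw [Finset.mem_powersetCard] at he
      by_cases hae : a ∈ e
      · rw [← Finset.insert_erase hae]
        apply hV
        rw [Finset.mem_powersetCard]
        refine ⟨fun x hx => ?_, by rw [Finset.card_erase_of_mem hae]; omega⟩
        rw [Finset.mem_erase] at hx
        exact hUV (Finset.mem_of_mem_insert_of_ne (he.1 hx.2) hx.1)
      · apply hU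
        rw [Finset.mem_powersetCard]
        exact ⟨(Finset.subset_insert_iff_of_notMem hae).1 he.1, he.2⟩
    intro s
    induction s with
    | zero => exact fun t => ⟨0, fun A _ χ => Or.inl ⟨∅, by simp, rfl, by simp⟩⟩
    | succ s ihs =>
      intro t
      induction t with
      | zero => exact ⟨0, fun A _ χ => Or.inr ⟨∅, by simp, rfl, by simp⟩⟩
      | succ t iht =>
        obtain ⟨N₁, h₁⟩ := ihs (t + 1)
        obtain ⟨N₂, h₂⟩ := iht
        obtain ⟨M, hM⟩ := ihk N₁ N₂
        refine ⟨M + 1, fun A hA χ => ?_⟩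
        obtain ⟨a, ha⟩ := Finset.card_pos.1 (by omega : 0 < A.card)
        have hsub : A.erase a ⊆ A := Finset.erase_subset a A
        rcases hM (A.erase a) (by rw [Finset.card_erase_of_mem ha]; omega)
          (fun e => χ (insert a e)) with ⟨V, hVA, hVc, hV⟩ | ⟨V, hVA, hVc, hV⟩
        · rcases h₁ V hVc.ge χ with ⟨U, hUV, hUc, hU⟩ | ⟨U, hUV, hUc, hU⟩
          · have haU : a ∉ U := fun h => Finset.notMem_erase a A (hVA (hUV h))
            exact Or.inl ⟨insert a U, Finset.insert_subset ha ((hUV.trans hVA).trans hsub),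
              by rw [Finset.card_insert_of_notMem haU, hUc], extend χ true a U V hUV hV hU⟩
          · exact Or.inr ⟨U, (hUV.trans hVA).trans hsub, hUc, hU⟩
        · rcases h₂ V hVc.ge χ with ⟨U, hUV, hUc, hU⟩ | ⟨U, hUV, hUc, hU⟩
          · exact Or.inl ⟨U, (hUV.trans hVA).trans hsub, hUc, hU⟩
          · have haU : a ∉ U := fun h => Finset.notMem_erase a A (hVA (hUV h))
            exact Or.inr ⟨insert a U, Finset.insert_subset ha ((hUV.trans hVA).trans hsub),
              by rw [Finset.card_insert_of_notMem haU, hUc], extend χ false a U V hUV hV hU⟩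

theorem lt_ehRamsey {k t n N : ℕ} (ht : t ≤ k + 1) (χ : Finset ℕ → Bool)
    (hred : ∀ S ⊆ Finset.range N, S.card = k + 1 →
      ((S.powersetCard k).filter (fun e => χ e = true)).card < t)
    (hblue : ∀ T ⊆ Finset.range N, T.card = n → ∃ e ∈ T.powersetCard k, χ e = true) :
    N < ehRamsey k t n := by
  obtain ⟨R, hR⟩ := hypergraph_ramsey k (k + 1) n
  by_contra! hle
  have hmem := Nat.sInf_mem (s := {N : ℕ | ∀ χ : Finset ℕ → Bool,
    (∃ S ⊆ Finset.range N, S.card = k + 1 ∧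
        t ≤ ((S.powersetCard k).filter (fun e => χ e = true)).card) ∨
    (∃ T ⊆ Finset.range N, T.card = n ∧ ∀ e ∈ T.powersetCard k, χ e = false)}) ⟨R, fun χ => by
      rcases hR (Finset.range R) (by simp) χ with ⟨S, hS, hSc, h⟩ | h
      · refine Or.inl ⟨S, hS, hSc, ?_⟩
        rwa [Finset.filter_true_of_mem h, Finset.card_powersetCard, hSc, Nat.choose_succ_self_right]
      · exact Or.inr h⟩
  have hsub : Finset.range (ehRamsey k t n) ⊆ Finset.range N := Finset.range_subset_range.2 hle
  rcases hmem χ with ⟨S, hS, hSc, h⟩ | ⟨T, hT, hTc, h⟩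
  · exact absurd (hred S (hS.trans hsub) hSc) (not_lt.2 h)
  · obtain ⟨e, he, hχ⟩ := hblue T (hT.trans hsub) hTc
    simp [h e he] at hχ

theorem exists_coloring_of_ehRamsey (k t : ℕ) {n : ℕ} (hn : 0 < n) :
    ∃ χ : Finset ℕ → Bool,
      (∀ S ⊆ Finset.range (ehRamsey k t n - 1), S.card = k + 1 →
        ((S.powersetCard k).filter (fun e => χ e = true)).card < t) ∧
      (∀ T ⊆ Finset.range (ehRamsey k t n - 1), T.card = n →
        ∃ e ∈ T.powersetCard k, χ e = true) := by
  rcases Nat.eq_zero_or_pos (ehRamsey k t n) with h0 | hpos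
  · simp only [h0, Nat.zero_sub, Finset.range_zero, Finset.subset_empty]
    refine ⟨fun _ => true, ?_, ?_⟩
    · rintro S rfl h
      simp at h
    · rintro T rfl h
      simp only [Finset.card_empty] at h
      omega
  · have h := Nat.notMem_of_lt_sInf (show ehRamsey k t n - 1 < ehRamsey k t n by omega)
    simp only [Set.mem_ofPred_eq, not_forall, not_or, not_exists, not_and, not_le,
      Bool.not_eq_false] at h
    obtain ⟨χ, hS, hT⟩ := h
    exact ⟨χ, hS, fun T h hc => by simpa using hT T h hc⟩

/-- The highest binary position at which two distinct numbers differ. -/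
noncomputable def topDiff (u v : ℕ) : ℕ := sInf {j | u / 2 ^ j = v / 2 ^ j} - 1

theorem topDiff_lt_iff {u v j : ℕ} (huv : u < v) :
    topDiff u v < j ↔ u / 2 ^ j = v / 2 ^ j := by
  have hne : ({j | u / 2 ^ j = v / 2 ^ j} : Set ℕ).Nonempty :=
    ⟨v, by rw [Set.mem_ofPred_eq, Nat.div_eq_of_lt (huv.trans Nat.lt_two_pow_self),
      Nat.div_eq_of_lt Nat.lt_two_pow_self]⟩
  have hmem : u / 2 ^ _ = v / 2 ^ _ := Nat.sInf_mem hne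
  have hpos : sInf {j | u / 2 ^ j = v / 2 ^ j} ≠ 0 := by
    intro h
    rw [h] at hmem
    simp at hmem
    omega
  have hle : sInf {j | u / 2 ^ j = v / 2 ^ j} ≤ j ↔ u / 2 ^ j = v / 2 ^ j := by
    refine ⟨fun h => ?_, fun h => Nat.sInf_le h⟩
    obtain ⟨i, rfl⟩ := Nat.exists_eq_add_of_le h
    rw [pow_add, ← Nat.div_div_eq_div_mul, ← Nat.div_div_eq_div_mul, hmem]
  rw [← hle, topDiff]
  omega

theorem topDiff_lt {u v N : ℕ} (huv : u < v) (hv : v < 2 ^ N) : topDiff u v < N := by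
  rw [topDiff_lt_iff huv, Nat.div_eq_of_lt hv, Nat.div_eq_of_lt (huv.trans hv)]

theorem topDiff_eq_max {u v w : ℕ} (huv : u < v) (hvw : v < w) :
    topDiff u w = max (topDiff u v) (topDiff v w) := by
  refine eq_of_forall_gt_iff fun j => ?_
  rw [max_lt_iff, topDiff_lt_iff huv, topDiff_lt_iff hvw, topDiff_lt_iff (huv.trans hvw)]
  have h₁ : u / 2 ^ j ≤ v / 2 ^ j := Nat.div_le_div_right huv.le
  have h₂ : v / 2 ^ j ≤ w / 2 ^ j := Nat.div_le_div_right hvw.le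
  omega

theorem topDiff_ne {u v w : ℕ} (huv : u < v) (hvw : v < w) : topDiff u v ≠ topDiff v w := by
  intro h
  have h₁ := (topDiff_lt_iff huv).1 (Nat.lt_succ_self _)
  have h₂ := (topDiff_lt_iff hvw).1 (h.symm.trans_lt (Nat.lt_succ_self (topDiff u v)))
  have h₃ := (topDiff_lt_iff huv).not.1 (lt_irrefl (topDiff u v))
  have h₄ := (topDiff_lt_iff hvw).not.1 (lt_irrefl (topDiff v w))
  have h₅ : u / 2 ^ topDiff u v ≤ v / 2 ^ topDiff u v := Nat.div_le_div_right huv.le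
  have h₆ : v / 2 ^ topDiff u v ≤ w / 2 ^ topDiff u v := Nat.div_le_div_right hvw.le
  rw [Nat.succ_eq_add_one, pow_succ, ← Nat.div_div_eq_div_mul, ← Nat.div_div_eq_div_mul] at h₁ h₂
  rw [← h] at h₄
  omega

/-- The values `topDiff p q` over the elements `q > p` of `T`. -/
noncomputable def upDiffs (T : Finset ℕ) (p : ℕ) : Finset ℕ :=
  (T.filter (p < ·)).image (topDiff p)

/-- The values `topDiff q p` over the elements `q < p` of `T`. -/
noncomputable def downDiffs (T : Finset ℕ) (p : ℕ) : Finset ℕ :=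
  (T.filter (· < p)).image (topDiff · p)

theorem upDiffs_mono {T U : Finset ℕ} (h : T ⊆ U) (p : ℕ) : upDiffs T p ⊆ upDiffs U p :=
  Finset.image_subset_image (Finset.filter_subset_filter _ h)

theorem downDiffs_mono {T U : Finset ℕ} (h : T ⊆ U) (p : ℕ) : downDiffs T p ⊆ downDiffs U p :=
  Finset.image_subset_image (Finset.filter_subset_filter _ h)

theorem card_le_two_pow_of_diffs_le (m : ℕ) : ∀ T : Finset ℕ,
    (∀ p ∈ T, (upDiffs T p).card + (downDiffs T p).card ≤ m) → T.card ≤ 2 ^ m := by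
  induction m with
  | zero =>
    intro T hT
    rw [pow_zero, Finset.card_le_one]
    have key : ∀ p ∈ T, ∀ q ∈ T, ¬ p < q := by
      intro p hp q hq hpq
      have h : topDiff p q ∈ upDiffs T p :=
        Finset.mem_image_of_mem _ (Finset.mem_filter.2 ⟨hq, hpq⟩)
      have := Finset.card_pos.2 ⟨_, h⟩
      have := hT p hp
      omega
    intro p hp q hq
    have := key p hp q hq
    have := key q hq p hp
    omega
  | succ m ih =>
    intro T hT
    rcases le_or_gt T.card 1 with h1 | h1
    · exact h1.trans Nat.one_le_two_pow
    have hne : T.Nonempty := Finset.card_pos.1 (by omega)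
    set a := T.min' hne with ha
    set b := T.max' hne with hb
    have haT : a ∈ T := T.min'_mem hne
    have hbT : b ∈ T := T.max'_mem hne
    have hab : a < b := T.min'_lt_max'_of_card h1
    have hmin : ∀ p ∈ T, a ≤ p := fun p hp => T.min'_le p hp
    have hmax : ∀ p ∈ T, p ≤ b := fun p hp => T.le_max' p hp
    set P : ℕ → Prop := fun p => a < p ∧ topDiff a p = topDiff a b
    rw [← Finset.card_filter_add_card_filter_not P]
    have hhigh : (T.filter P).card ≤ 2 ^ m := by
      refine ih _ fun p hp => ?_
      obtain ⟨hpT, hap, hpD⟩ := Finset.mem_filter.1 hp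
      have hlt : (downDiffs (T.filter P) p).card < (downDiffs T p).card := by
        refine Finset.card_lt_card ((Finset.ssubset_iff_of_subset
          (downDiffs_mono (Finset.filter_subset P T) p)).2 ⟨topDiff a b, ?_, ?_⟩)
        · exact Finset.mem_image.2 ⟨a, Finset.mem_filter.2 ⟨haT, hap⟩, hpD⟩
        · intro h
          obtain ⟨q, hq, hqD⟩ := Finset.mem_image.1 h
          obtain ⟨hq, hqp⟩ := Finset.mem_filter.1 hq
          obtain ⟨-, haq, hq'⟩ := Finset.mem_filter.1 hq
          exact topDiff_ne haq hqp (hq'.trans hqD.symm)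
      have := Finset.card_le_card (upDiffs_mono (Finset.filter_subset P T) p)
      have := hT p hpT
      omega
    have hlow : (T.filter (fun p => ¬ P p)).card ≤ 2 ^ m := by
      refine ih _ fun p hp => ?_
      obtain ⟨hpT, hpP⟩ := Finset.mem_filter.1 hp
      have hpb : p < b := lt_of_le_of_ne (hmax p hpT) fun h => hpP ⟨h ▸ hab, h ▸ rfl⟩
      have hlt : (upDiffs (T.filter (fun p => ¬ P p)) p).card < (upDiffs T p).card := by
        refine Finset.card_lt_card ((Finset.ssubset_iff_of_subset
          (upDiffs_mono (Finset.filter_subset _ T) p)).2 ⟨topDiff a b, ?_, ?_⟩)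
        · refine Finset.mem_image.2 ⟨b, Finset.mem_filter.2 ⟨hbT, hpb⟩, ?_⟩
          rcases (hmin p hpT).eq_or_lt with h | h
          · rw [h]
          · have hm := topDiff_eq_max h hpb
            have : topDiff a p ≠ topDiff a b := fun h' => hpP ⟨h, h'⟩
            omega
        · intro h
          obtain ⟨q, hq, hqD⟩ := Finset.mem_image.1 h
          obtain ⟨hq, hpq⟩ := Finset.mem_filter.1 hq
          obtain ⟨hqT, hqP⟩ := Finset.mem_filter.1 hq
          have haq : a < q := (hmin p hpT).trans_lt hpq
          refine hqP ⟨haq, ?_⟩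
          have h₁ : topDiff a q ≤ topDiff a b := by
            rcases (hmax q hqT).eq_or_lt with h | h
            · rw [h]
            · rw [topDiff_eq_max haq h]
              exact le_max_left _ _
          rcases (hmin p hpT).eq_or_lt with h | h
          · rw [h, hqD, ← h]
          · have hm := topDiff_eq_max h hpq
            omega
      have := Finset.card_le_card (downDiffs_mono (Finset.filter_subset (fun p => ¬ P p) T) p)
      have := hT p hpT
      omega
    rw [pow_succ]
    omega

/-- `a, b, c, d` have monotone consecutive `topDiff`s, forming a triple that is red in `φ`. -/
def IsSteppedRed (φ : Finset ℕ → Bool) (a b c d : ℕ) : Prop :=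
  (topDiff a b < topDiff b c ∧ topDiff b c < topDiff c d ∨
    topDiff c d < topDiff b c ∧ topDiff b c < topDiff a b) ∧
  φ {topDiff a b, topDiff b c, topDiff c d} = true

open Classical in
/-- The stepped-up coloring of `4`-sets obtained from a coloring `φ` of `3`-sets. -/
noncomputable def stepUp (φ : Finset ℕ → Bool) (s : Finset ℕ) : Bool :=
  decide (∃ a b c d, s.sort = [a, b, c, d] ∧ IsSteppedRed φ a b c d)

theorem stepUp_eq_true_iff (φ : Finset ℕ → Bool) {a b c d : ℕ} (hab : a < b) (hbc : b < c)
    (hcd : c < d) : stepUp φ {a, b, c, d} = true ↔ IsSteppedRed φ a b c d := by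
  have hsort : Finset.sort ({a, b, c, d} : Finset ℕ) = [a, b, c, d] := by
    rw [Finset.sort_insert, Finset.sort_insert, Finset.sort_insert, Finset.sort_singleton] <;>
      simp <;> omega
  simp [stepUp, hsort]

theorem exists_stepUp_red {φ : Finset ℕ → Bool} {n N : ℕ} (hn : 0 < n)
    (hφ : ∀ T ⊆ Finset.range N, T.card = n → ∃ e ∈ T.powersetCard 3, φ e = true)
    {T : Finset ℕ} (hT : T ⊆ Finset.range (2 ^ N)) (hTc : T.card = 2 ^ (2 * n)) :
    ∃ e ∈ T.powersetCard 4, stepUp φ e = true := by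
  have hex : ∃ p ∈ T, n ≤ (upDiffs T p).card ∨ n ≤ (downDiffs T p).card := by
    by_contra! h
    have := card_le_two_pow_of_diffs_le (2 * n - 1) T fun p hp => by
      have := h p hp
      omega
    rw [hTc] at this
    have := Nat.pow_lt_pow_right one_lt_two (show 2 * n - 1 < 2 * n by omega)
    omega
  have triple {D : Finset ℕ} (hD : D ⊆ Finset.range N) (hDc : n ≤ D.card) :
      ∃ x y z, x < y ∧ y < z ∧ x ∈ D ∧ y ∈ D ∧ z ∈ D ∧ φ {x, y, z} = true := by
    obtain ⟨E, hED, hEc⟩ := Finset.exists_subset_card_eq hDc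
    obtain ⟨e, he, hred⟩ := hφ E (hED.trans hD) hEc
    obtain ⟨heE, hec⟩ := Finset.mem_powersetCard.1 he
    have heq := Finset.image_orderEmbOfFin_univ e hec
    have hm := fun i => hED (heE (e.orderEmbOfFin_mem hec i))
    refine ⟨e.orderEmbOfFin hec 0, e.orderEmbOfFin hec 1, e.orderEmbOfFin hec 2,
      by simp, by simp, hm 0, hm 1, hm 2, ?_⟩
    rw [← hred]
    refine congrArg φ (Eq.trans ?_ heq)
    simp [Fin.univ_succ]
  obtain ⟨p, hp, hcard | hcard⟩ := hex
  · obtain ⟨x, y, z, hxy, hyz, hx, hy, hz, hred⟩ := triple (fun d hd => by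
      obtain ⟨q, hq, rfl⟩ := Finset.mem_image.1 hd
      obtain ⟨hqT, hpq⟩ := Finset.mem_filter.1 hq
      exact Finset.mem_range.2 (topDiff_lt hpq (Finset.mem_range.1 (hT hqT)))) hcard
    simp only [upDiffs, Finset.mem_image, Finset.mem_filter] at hx hy hz
    obtain ⟨u, ⟨huT, hpu⟩, rfl⟩ := hx
    obtain ⟨v, ⟨hvT, hpv⟩, rfl⟩ := hy
    obtain ⟨w, ⟨hwT, hpw⟩, rfl⟩ := hz
    have next {q r : ℕ} (hpq : p < q) (hpr : p < r) (h : topDiff p q < topDiff p r) :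
        q < r ∧ topDiff q r = topDiff p r := by
      have hqr : q < r := by
        rcases lt_trichotomy q r with h' | rfl | h'
        · exact h'
        · exact absurd h (lt_irrefl _)
        · have := topDiff_eq_max hpr h'
          omega
      have := topDiff_eq_max hpq hqr
      exact ⟨hqr, by omega⟩
    obtain ⟨huv, h₁⟩ := next hpu hpv hxy
    obtain ⟨hvw, h₂⟩ := next hpv hpw hyz
    refine ⟨{p, u, v, w}, ?_, (stepUp_eq_true_iff φ hpu huv hvw).2 ⟨?_, ?_⟩⟩
    · rw [Finset.mem_powersetCard]
      refine ⟨by simp [Finset.insert_subset_iff, *], Finset.card_eq_succ.2 ?_⟩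
      exact ⟨p, {u, v, w}, by simp; omega, rfl,
        Finset.card_eq_three.2 ⟨u, v, w, by omega, by omega, by omega, rfl⟩⟩
    · left
      omega
    · rwa [h₁, h₂]
  · obtain ⟨x, y, z, hxy, hyz, hx, hy, hz, hred⟩ := triple (fun d hd => by
      obtain ⟨q, hq, rfl⟩ := Finset.mem_image.1 hd
      obtain ⟨hqT, hpq⟩ := Finset.mem_filter.1 hq
      exact Finset.mem_range.2 (topDiff_lt hpq (Finset.mem_range.1 (hT hp)))) hcard
    simp only [downDiffs, Finset.mem_image, Finset.mem_filter] at hx hy hz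
    obtain ⟨u, ⟨huT, hup⟩, rfl⟩ := hx
    obtain ⟨v, ⟨hvT, hvp⟩, rfl⟩ := hy
    obtain ⟨w, ⟨hwT, hwp⟩, rfl⟩ := hz
    have next {q r : ℕ} (hqp : q < p) (hrp : r < p) (h : topDiff q p < topDiff r p) :
        r < q ∧ topDiff r q = topDiff r p := by
      have hrq : r < q := by
        rcases lt_trichotomy r q with h' | rfl | h'
        · exact h'
        · exact absurd h (lt_irrefl _)
        · have := topDiff_eq_max h' hrp
          omega
      have := topDiff_eq_max hrq hqp
      exact ⟨hrq, by omega⟩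
    obtain ⟨hvu, h₁⟩ := next hup hvp hxy
    obtain ⟨hwv, h₂⟩ := next hvp hwp hyz
    refine ⟨{w, v, u, p}, ?_, (stepUp_eq_true_iff φ hwv hvu hup).2 ⟨?_, ?_⟩⟩
    · rw [Finset.mem_powersetCard]
      refine ⟨by simp [Finset.insert_subset_iff, *], Finset.card_eq_succ.2 ?_⟩
      exact ⟨w, {v, u, p}, by simp; omega, rfl,
        Finset.card_eq_three.2 ⟨v, u, p, by omega, by omega, by omega, rfl⟩⟩
    · right
      omega
    · rw [h₁, h₂, ← hred]
      congr 1
      ext i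
      simp
      tauto

theorem card_filter_powersetCard_eq_sum (χ : Finset ℕ → Bool) {k : ℕ} {S : Finset ℕ}
    (hS : S.card = k + 1) :
    ((S.powersetCard k).filter (fun e => χ e = true)).card =
      ∑ v ∈ S, if χ (S.erase v) = true then 1 else 0 := by
  have himage : S.powersetCard k = S.image S.erase := by
    ext e
    rw [Finset.mem_powersetCard, Finset.mem_image]
    constructor
    · rintro ⟨heS, hec⟩
      obtain ⟨v, hv⟩ := Finset.card_eq_one.1
        (show (S \ e).card = 1 by rw [Finset.card_sdiff_of_subset heS]; omega)
      have hvS : v ∈ S \ e := hv ▸ Finset.mem_singleton_self v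
      refine ⟨v, (Finset.mem_sdiff.1 hvS).1, ?_⟩
      rw [← Finset.sdiff_singleton_eq_erase, ← hv, Finset.sdiff_sdiff_eq_self heS]
    · rintro ⟨v, hv, rfl⟩
      exact ⟨Finset.erase_subset v S, by rw [Finset.card_erase_of_mem hv]; omega⟩
  rw [Finset.card_filter, himage, Finset.sum_image (Finset.erase_injOn S)]

theorem card_red_four (χ : Finset ℕ → Bool) {a b c d : ℕ} (hab : a ≠ b) (hac : a ≠ c)
    (had : a ≠ d) (hbc : b ≠ c) (hbd : b ≠ d) (hcd : c ≠ d) :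
    (((({a, b, c, d} : Finset ℕ)).powersetCard 3).filter (fun e => χ e = true)).card =
      (if χ {b, c, d} = true then 1 else 0) + (if χ {a, c, d} = true then 1 else 0) +
      (if χ {a, b, d} = true then 1 else 0) + (if χ {a, b, c} = true then 1 else 0) := by
  have ha : ({a, b, c, d} : Finset ℕ).erase a = {b, c, d} := by ext; simp; omega
  have hb : ({a, b, c, d} : Finset ℕ).erase b = {a, c, d} := by ext; simp; omega
  have hc : ({a, b, c, d} : Finset ℕ).erase c = {a, b, d} := by ext; simp; omega
  have hd : ({a, b, c, d} : Finset ℕ).erase d = {a, b, c} := by ext; simp; omega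
  rw [card_filter_powersetCard_eq_sum χ (by simp [*]), Finset.sum_insert (by simp [*]),
    Finset.sum_insert (by simp [*]), Finset.sum_insert (by simp [*]), Finset.sum_singleton,
    ha, hb, hc, hd]
  ring

theorem card_red_five (χ : Finset ℕ → Bool) {a b c d e : ℕ} (hab : a < b) (hbc : b < c)
    (hcd : c < d) (hde : d < e) :
    (((({a, b, c, d, e} : Finset ℕ)).powersetCard 4).filter (fun e => χ e = true)).card =
      (if χ {b, c, d, e} = true then 1 else 0) + (if χ {a, c, d, e} = true then 1 else 0) +
      (if χ {a, b, d, e} = true then 1 else 0) + (if χ {a, b, c, e} = true then 1 else 0) +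
      (if χ {a, b, c, d} = true then 1 else 0) := by
  have ha : ({a, b, c, d, e} : Finset ℕ).erase a = {b, c, d, e} := by ext; simp; omega
  have hb : ({a, b, c, d, e} : Finset ℕ).erase b = {a, c, d, e} := by ext; simp; omega
  have hc : ({a, b, c, d, e} : Finset ℕ).erase c = {a, b, d, e} := by ext; simp; omega
  have hd : ({a, b, c, d, e} : Finset ℕ).erase d = {a, b, c, e} := by ext; simp; omega
  have he : ({a, b, c, d, e} : Finset ℕ).erase e = {a, b, c, d} := by ext; simp; omega
  have ha' : a ∉ ({b, c, d, e} : Finset ℕ) := by simp; omega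
  have hb' : b ∉ ({c, d, e} : Finset ℕ) := by simp; omega
  have hc' : c ∉ ({d, e} : Finset ℕ) := by simp; omega
  have hd' : d ∉ ({e} : Finset ℕ) := by simp; omega
  rw [card_filter_powersetCard_eq_sum χ (by
      rw [Finset.card_insert_of_notMem ha', Finset.card_insert_of_notMem hb',
        Finset.card_insert_of_notMem hc', Finset.card_pair hde.ne]),
    Finset.sum_insert ha', Finset.sum_insert hb', Finset.sum_insert hc', Finset.sum_insert hd',
    Finset.sum_singleton, ha, hb, hc, hd, he]
  ring

theorem card_stepUp_red_lt {φ : Finset ℕ → Bool} {N : ℕ}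
    (hφ : ∀ S ⊆ Finset.range N, S.card = 4 →
      ((S.powersetCard 3).filter (fun e => φ e = true)).card < 3)
    {S : Finset ℕ} (hS : S ⊆ Finset.range (2 ^ N)) (hSc : S.card = 5) :
    ((S.powersetCard 4).filter (fun e => stepUp φ e = true)).card < 4 := by
  obtain ⟨a, b, c, d, e, hab, hbc, hcd, hde, rfl⟩ :
      ∃ a b c d e, a < b ∧ b < c ∧ c < d ∧ d < e ∧ S = {a, b, c, d, e} := by
    let f := S.orderEmbOfFin hSc
    refine ⟨f 0, f 1, f 2, f 3, f 4, by simp, by simp, by simp, by simp, ?_⟩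
    rw [← Finset.image_orderEmbOfFin_univ S hSc]
    simp [Fin.univ_succ, f]
  have hN {x : ℕ} (hx : x ∈ ({a, b, c, d, e} : Finset ℕ)) : x < 2 ^ N := Finset.mem_range.1 (hS hx)
  have h₁ := topDiff_lt hab (hN (by simp))
  have h₂ := topDiff_lt hbc (hN (by simp))
  have h₃ := topDiff_lt hcd (hN (by simp))
  have h₄ := topDiff_lt hde (hN (by simp))
  rw [card_red_five _ hab hbc hcd hde]
  simp only [stepUp_eq_true_iff φ hbc hcd hde, stepUp_eq_true_iff φ (hab.trans hbc) hcd hde,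
    stepUp_eq_true_iff φ hab (hbc.trans hcd) hde, stepUp_eq_true_iff φ hab hbc (hcd.trans hde),
    stepUp_eq_true_iff φ hab hbc hcd, IsSteppedRed, topDiff_eq_max hab hbc,
    topDiff_eq_max hbc hcd, topDiff_eq_max hcd hde]
  generalize topDiff a b = x at *
  generalize topDiff b c = y at *
  generalize topDiff c d = z at *
  generalize topDiff d e = w at *
  have hfour (hxy : x ≠ y) (hxz : x ≠ z) (hxw : x ≠ w) (hyz : y ≠ z) (hyw : y ≠ w) (hzw : z ≠ w) :=
    card_red_four φ hxy hxz hxw hyz hyw hzw ▸ hφ {x, y, z, w}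
      (by simp [Finset.insert_subset_iff, *]) (by simp [*])
  by_cases hinc : x < y ∧ y < z ∧ z < w
  · obtain ⟨hxy, hyz, hzw⟩ := hinc
    have := hfour (by omega) (by omega) (by omega) (by omega) (by omega) (by omega)
    rw [max_eq_right hxy.le, max_eq_right hyz.le, max_eq_right hzw.le]
    simp only [hxy, hyz, hzw, hxy.trans hyz, hyz.trans hzw, true_and, true_or, and_true]
    split_ifs at this ⊢ <;> omega
  by_cases hdec : w < z ∧ z < y ∧ y < x
  · obtain ⟨hzw, hyz, hxy⟩ := hdec
    have := hfour (by omega) (by omega) (by omega) (by omega) (by omega) (by omega)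
    rw [max_eq_left hxy.le, max_eq_left hyz.le, max_eq_left hzw.le]
    simp only [hxy, hyz, hzw, hyz.trans hxy, hzw.trans hyz, true_and, or_true, and_true]
    split_ifs at this ⊢ <;> omega
  split_ifs <;> omega

/-- For all sufficiently large `n`, `r_4(5,4;2^(2n)) > 2^(r_3(4,3;n) - 1)`. -/
theorem stmt1 : ∃ n0 : ℕ, ∀ n : ℕ, n0 ≤ n →
    2 ^ (ehRamsey 3 3 n - 1) < ehRamsey 4 4 (2 ^ (2 * n)) := by
  refine ⟨1, fun n hn => ?_⟩
  obtain ⟨φ, hred, hblue⟩ := exists_coloring_of_ehRamsey 3 3 hn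
  exact lt_ehRamsey (by norm_num) (stepUp φ) (fun S hS hSc => card_stepUp_red_lt hred hS hSc)
    fun T hT hTc => exists_stepUp_red hn hblue hT hTc
end
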